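/- Let p be a prime and let A be a finite subset of the field F_p = Z/pZ with |A| ≥ 2. For a natural number n ≥ 1, let P_n(A) denote the set of all elements of F_p that arise as the permanent of some n × n matrix with entries in A, where the permanent of a matrix M of size k is per(M) = Σ_{σ ∈ S_k} Π_i M(i, σ(i)). Then |P_n(A)| ≥ (1/8) · min(|A|^{(log₂ n)/10}, p). -/

import Mathlib

/-- The permanent of a `k × k` matrix: `per M = ∑_{σ ∈ S_k} ∏_i M (i, σ i)`. -/
def permanent {F : Type*} [Field F] {k : ℕ} (M : Matrix (Fin k) (Fin k) F) : F :=
  ∑ σ : Equiv.Perm (Fin k), ∏ i, M i (σ i)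

/-- `permSet n A` is the set of all permanents of `n × n` matrices with entries in `A`. -/
def permSet {F : Type*} [Field F] (n : ℕ) (A : Finset F) : Set F :=
  {d | ∃ M : Matrix (Fin n) (Fin n) F, (∀ i j, M i j ∈ A) ∧ permanent M = d}

section SubpermanentSums

variable {F ι L : Type*} [Field F] [DecidableEq L]

lemma sum_single_one_apply (Q : Finset L) (l : L) :
    (∑ x ∈ Q, Finsupp.single x 1 : L →₀ ℕ) l = if l ∈ Q then 1 else 0 := by
  simp [Finsupp.finsetSum_apply, Finsupp.single_apply]

variable [Fintype L]

/-- The linear form with constant term `1` whose coefficients are the entries of row `i`. -/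
noncomputable def rowPoly (b : ι → L → F) (i : ι) : MvPolynomial L F :=
  1 + ∑ l, MvPolynomial.C (b i l) * MvPolynomial.X l

/-- The sum of the products `∏_{l ∈ Q} b (φ l) l` over all injections `φ` from the columns `Q` to the
rows `s`. -/
noncomputable def phi (b : ι → L → F) (Q : Finset L) (s : Finset ι) : F :=
  MvPolynomial.coeff (∑ l ∈ Q, Finsupp.single l 1) (∏ i ∈ s, rowPoly b i)

lemma phi_no_rows (b : ι → L → F) {Q : Finset L} (hQ : Q.Nonempty) : phi b Q ∅ = 0 := by
  obtain ⟨l, hl⟩ := hQ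
  rw [phi, Finset.prod_empty, MvPolynomial.coeff_one, if_neg]
  intro h
  have := DFunLike.congr_fun h l
  rw [sum_single_one_apply] at this
  simp [hl] at this

variable [DecidableEq ι]

lemma phi_insert (b : ι → L → F) (Q : Finset L) {s : Finset ι} {j : ι} (hj : j ∉ s) :
    phi b Q (insert j s) = phi b Q s + ∑ l ∈ Q, b j l * phi b (Q.erase l) s := by
  unfold phi
  rw [Finset.prod_insert hj]
  generalize ∏ i ∈ s, rowPoly b i = f
  rw [rowPoly, add_mul, one_mul, MvPolynomial.coeff_add, Finset.sum_mul, MvPolynomial.coeff_sum]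
  congr 1
  rw [← Finset.sum_subset (Finset.subset_univ Q)]
  · refine Finset.sum_congr rfl fun l hl => ?_
    rw [mul_assoc, MvPolynomial.coeff_C_mul, MvPolynomial.coeff_X_mul']
    have h1 : l ∈ (∑ x ∈ Q, Finsupp.single x 1 : L →₀ ℕ).support := by
      rw [Finsupp.mem_support_iff, sum_single_one_apply]; simp [hl]
    rw [if_pos h1, ← Finset.add_sum_erase Q _ hl, add_tsub_cancel_left]
  · intro l _ hl
    rw [mul_assoc, MvPolynomial.coeff_C_mul, MvPolynomial.coeff_X_mul', if_neg, mul_zero]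
    rw [Finsupp.mem_support_iff, sum_single_one_apply]; simp [hl]

lemma phi_no_cols (b : ι → L → F) (s : Finset ι) : phi b ∅ s = 1 := by
  induction s using Finset.induction_on with
  | empty => simp [phi]
  | insert j s hj ih => rw [phi_insert b _ hj, ih]; simp

lemma phi_erase_row (b : ι → L → F) (Q : Finset L) {s : Finset ι} {j : ι} (hj : j ∈ s) :
    phi b Q (s.erase j) = phi b Q s - ∑ l ∈ Q, b j l * phi b (Q.erase l) (s.erase j) := by
  have h := phi_insert b Q (Finset.notMem_erase j s)
  rw [Finset.insert_erase hj] at h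
  rw [h]; ring

lemma phi_congr {b b' : ι → L → F} {Q : Finset L} {s : Finset ι}
    (h : ∀ i ∈ s, ∀ l ∈ Q, b i l = b' i l) : phi b Q s = phi b' Q s := by
  induction s using Finset.induction_on generalizing Q with
  | empty => simp [phi]
  | insert j s hj ih =>
    rw [phi_insert b _ hj, phi_insert b' _ hj,
      ih fun i hi l hl => h i (Finset.mem_insert_of_mem hi) l hl]
    congr 1
    refine Finset.sum_congr rfl fun l hl => ?_
    rw [h j (Finset.mem_insert_self j s) l hl, ih fun i hi l' hl' =>
      h i (Finset.mem_insert_of_mem hi) l' (Finset.mem_of_mem_erase hl')]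

/-- Expansion along a column. -/
lemma phi_insert_col (b : ι → L → F) {Q : Finset L} {k : L} (hk : k ∉ Q) (s : Finset ι) :
    phi b (insert k Q) s = ∑ i ∈ s, b i k * phi b Q (s.erase i) := by
  induction s using Finset.induction_on generalizing Q with
  | empty => simp [phi_no_rows]
  | insert j s hj ih =>
    rw [phi_insert b _ hj, ih hk, Finset.sum_insert hk, Finset.erase_insert hk,
      Finset.sum_insert hj, Finset.erase_insert hj]
    have h1 : ∀ i ∈ s, b i k * phi b Q ((insert j s).erase i) =
        b i k * phi b Q (s.erase i) +
          ∑ l ∈ Q, b j l * (b i k * phi b (Q.erase l) (s.erase i)) := by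
      intro i hi
      have hij : j ≠ i := fun h => hj (h ▸ hi)
      rw [Finset.erase_insert_of_ne hij, phi_insert b _ (by simp [hj]), mul_add, Finset.mul_sum]
      congr 1
      exact Finset.sum_congr rfl fun l _ => by ring
    have h2 : ∀ l ∈ Q, b j l * phi b ((insert k Q).erase l) s =
        ∑ i ∈ s, b j l * (b i k * phi b (Q.erase l) (s.erase i)) := by
      intro l hl
      have hlk : k ≠ l := fun h => hk (h ▸ hl)
      rw [Finset.erase_insert_of_ne hlk, ih (by simp [hk]), Finset.mul_sum]
    rw [Finset.sum_congr rfl h1, Finset.sum_congr rfl h2, Finset.sum_add_distrib, Finset.sum_comm]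
    ring

lemma phi_singleton (b : ι → L → F) (k : L) (s : Finset ι) : phi b {k} s = ∑ i ∈ s, b i k := by
  have := phi_insert_col b (Finset.notMem_empty k) s
  simpa [phi_no_cols] using this

/-- A column of ones contributes the number of rows left over by the other columns. -/
lemma phi_insert_ones (b : ι → L → F) {k : L} (hb : ∀ i, b i k = 1) {Q : Finset L} (hk : k ∉ Q)
    (s : Finset ι) : phi b (insert k Q) s = ((s.card : F) - Q.card) * phi b Q s := by
  induction s using Finset.induction_on generalizing Q with
  | empty =>
    rcases Q.eq_empty_or_nonempty with rfl | hQ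
    · simp [phi_no_rows]
    · simp [phi_no_rows, hQ]
  | insert j s hj ih =>
    rw [phi_insert b _ hj, ih hk, Finset.sum_insert hk, Finset.erase_insert hk, hb,
      phi_insert b Q hj]
    have h2 : ∀ l ∈ Q, b j l * phi b ((insert k Q).erase l) s =
        ((s.card : F) - Q.card + 1) * (b j l * phi b (Q.erase l) s) := by
      intro l hl
      have hlk : k ≠ l := fun h => hk (h ▸ hl)
      have hc : (Q.card : F) = ((Q.erase l).card : F) + 1 := by
        rw [← Finset.card_erase_add_one hl]; push_cast; ring
      rw [Finset.erase_insert_of_ne hlk, ih (by simp [hk]), hc]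
      ring
    rw [Finset.sum_congr rfl h2, ← Finset.mul_sum, Finset.card_insert_of_notMem hj]
    push_cast
    ring

lemma phi_univ_eq_sum_perm {n : ℕ} (M : Matrix (Fin n) (Fin n) F) :
    phi M Finset.univ Finset.univ = permanent M := by
  have hhom : ∀ i, (∑ l, MvPolynomial.C (M i l) * MvPolynomial.X l :
      MvPolynomial (Fin n) F).IsHomogeneous 1 := fun i =>
    MvPolynomial.IsHomogeneous.sum _ _ _ fun l _ => by
      simpa using (MvPolynomial.isHomogeneous_C (Fin n) (M i l)).mul
        (MvPolynomial.isHomogeneous_X F l)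
  unfold phi rowPoly
  rw [Finset.prod_one_add, MvPolynomial.coeff_sum,
    Finset.sum_eq_single_of_mem Finset.univ (by simp)]
  · rw [Finset.prod_univ_sum, MvPolynomial.coeff_sum, permanent]
    symm
    have hmon : ∀ f : Fin n → Fin n, MvPolynomial.coeff (∑ l, Finsupp.single l 1)
        (∏ i, (MvPolynomial.C (M i (f i)) * MvPolynomial.X (f i)) : MvPolynomial (Fin n) F) =
        if (∑ i, Finsupp.single (f i) 1 : Fin n →₀ ℕ) = ∑ l, Finsupp.single l 1
          then ∏ i, M i (f i) else 0 := by
      intro f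
      have : (∏ i, (MvPolynomial.C (M i (f i)) * MvPolynomial.X (f i)) : MvPolynomial (Fin n) F) =
          MvPolynomial.monomial (∑ i, Finsupp.single (f i) 1) (∏ i, M i (f i)) := by
        rw [MvPolynomial.monomial_sum_prod]
        refine Finset.prod_congr rfl fun i _ => ?_
        rw [MvPolynomial.C_mul_X_eq_monomial]
      rw [this, MvPolynomial.coeff_monomial]
    refine Finset.sum_of_injOn (fun σ : Equiv.Perm (Fin n) => (σ : Fin n → Fin n))
      (fun a _ b _ h => DFunLike.coe_injective h) (by simp) ?_ ?_
    · intro f _ hf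
      rw [hmon, if_neg]
      intro h
      have hs : Function.Surjective f := by
        intro l
        have := DFunLike.congr_fun h l
        rw [sum_single_one_apply] at this
        by_contra! hne
        simp [Finsupp.finsetSum_apply, hne] at this
      exact hf ⟨Equiv.ofBijective f (Finite.surjective_iff_bijective.1 hs), by simp, rfl⟩
    · intro σ _
      rw [hmon, if_pos]
      exact Equiv.sum_comp σ fun l => Finsupp.single l 1
  · intro t _ ht
    have hp : (∏ i ∈ t, ∑ l, MvPolynomial.C (M i l) * MvPolynomial.X l :
        MvPolynomial (Fin n) F).IsHomogeneous (∑ i ∈ t, 1) :=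
      MvPolynomial.IsHomogeneous.prod _ _ _ fun i _ => hhom i
    refine hp.coeff_eq_zero ?_
    have h2 : (∑ l : Fin n, Finsupp.single l 1 : Fin n →₀ ℕ).degree = n := by
      simp [map_sum]
    rw [h2]
    have : t.card < n := by
      have := Finset.card_lt_card (Finset.ssubset_univ_iff.2 ht)
      simpa using this
    simp; omega

end SubpermanentSums

section Padding

variable {F ι L : Type*} [Field F] [DecidableEq ι] [DecidableEq L] [Fintype L]

lemma phi_map {ι' L' : Type*} [DecidableEq ι'] [DecidableEq L'] [Fintype L'] (b : ι → L → F)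
    (e : ι' ↪ ι) (f : L' ↪ L) (Q : Finset L') (s : Finset ι') :
    phi b (Q.map f) (s.map e) = phi (fun i l => b (e i) (f l)) Q s := by
  induction s using Finset.induction_on generalizing Q with
  | empty =>
    rcases Q.eq_empty_or_nonempty with rfl | hQ
    · simp [phi_no_cols]
    · rw [Finset.map_empty, phi_no_rows _ (hQ.map (f := f)), phi_no_rows _ hQ]
  | insert j s hj ih =>
    rw [phi_insert _ _ hj, Finset.map_insert, phi_insert _ _ (by simpa using hj), ih,
      Finset.sum_map]
    congr 1
    refine Finset.sum_congr rfl fun l _ => ?_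
    rw [← ih, Finset.map_erase]

lemma phi_disjSum_ones {κ : Type*} [DecidableEq κ] [Fintype κ] (b : ι → L → F) (Q : Finset L)
    (s : Finset ι) (T : Finset κ) (hT : Q.card + T.card ≤ s.card) :
    phi (fun i => Sum.elim (b i) fun _ => 1) (Q.disjSum T) s =
      ((s.card - Q.card).descFactorial T.card : F) * phi b Q s := by
  induction T using Finset.induction_on with
  | empty =>
    have := phi_map (fun i => Sum.elim (b i) fun _ : κ => (1 : F)) (Function.Embedding.refl ι)
      Function.Embedding.inl Q s
    simpa using this
  | insert k T hk ih =>
    rw [Finset.card_insert_of_notMem hk] at hT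
    have h1 : Q.disjSum (insert k T) = insert (Sum.inr k) (Q.disjSum T) := by
      ext x; rcases x with x | x <;> simp
    rw [h1, phi_insert_ones _ (by simp) (by simpa using hk), ih (by omega),
      Finset.card_insert_of_notMem hk, Nat.descFactorial_succ, Finset.card_disjSum, Nat.cast_mul,
      Nat.cast_sub (by omega), Nat.cast_sub (by omega), Nat.cast_add]
    ring

/-- Completing a rectangular array by columns of ones turns the sums `phi` into permanents. -/
lemma factorial_mul_phi_mem_permSet [Fintype ι] {n : ℕ} {A : Finset F} (h1 : 1 ∈ A)
    (hι : Fintype.card ι = n) (hL : Fintype.card L ≤ n) {b : ι → L → F} (hb : ∀ i l, b i l ∈ A) :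
    ((n - Fintype.card L).factorial : F) * phi b Finset.univ Finset.univ ∈ permSet n A := by
  have hcard : Fintype.card (L ⊕ Fin (n - Fintype.card L)) = n := by simp; omega
  have e : Fin n ≃ ι := (Fintype.equivFinOfCardEq hι).symm
  have f : Fin n ≃ L ⊕ Fin (n - Fintype.card L) := (Fintype.equivFinOfCardEq hcard).symm
  refine ⟨Matrix.of fun i l => Sum.elim (b (e i)) (fun _ => 1) (f l), fun i l => ?_, ?_⟩
  · rw [Matrix.of_apply]
    rcases f l with x | x
    · exact hb _ _
    · exact h1
  · rw [← phi_univ_eq_sum_perm]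
    have h := phi_map (fun i => Sum.elim (b i) fun _ : Fin (n - Fintype.card L) => (1 : F))
      e.toEmbedding f.toEmbedding Finset.univ Finset.univ
    rw [Finset.map_univ_equiv, Finset.map_univ_equiv, ← Finset.univ_disjSum_univ,
      phi_disjSum_ones _ _ _ _ (by simp; omega)] at h
    simp only [Finset.card_univ, hι, Fintype.card_fin, Nat.descFactorial_self] at h
    exact h.symm

lemma ncard_permSet_image_mul (n : ℕ) (A : Finset F) {c : F} (hc : c ≠ 0) [DecidableEq F] :
    (permSet n (A.image (c * ·))).ncard = (permSet n A).ncard := by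
  have : permSet n (A.image (c * ·)) = (c ^ n * ·) '' permSet n A := by
    have hper : ∀ M : Matrix (Fin n) (Fin n) F,
        permanent (Matrix.of fun i j => c * M i j) = c ^ n * permanent M := by
      intro M
      simp only [permanent, Finset.mul_sum, Matrix.of_apply]
      simp [Finset.prod_mul_distrib]
    ext d
    constructor
    · rintro ⟨M, hM, rfl⟩
      simp only [Finset.mem_image] at hM
      choose N hN hNM using hM
      refine ⟨permanent (Matrix.of N), ⟨Matrix.of N, hN, rfl⟩, (hper _).symm.trans ?_⟩
      congr 1
      ext i j
      exact hNM i j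
    · rintro ⟨_, ⟨N, hN, rfl⟩, rfl⟩
      exact ⟨Matrix.of fun i j => c * N i j, fun i j => Finset.mem_image_of_mem _ (hN i j), hper N⟩
  rw [this]
  exact Set.ncard_image_of_injective _ (mul_right_injective₀ (pow_ne_zero n hc))

end Padding

section CauchyDavenport

open Finset Pointwise

variable {F ι L : Type*} [Field F] [DecidableEq ι] [DecidableEq L] [Fintype L]

lemma phi_ones {b : ι → L → F} {Q : Finset L} {s : Finset ι} (hb : ∀ i ∈ s, ∀ l, b i l = 1)
    (hQ : Q.card ≤ s.card) : phi b Q s = (s.card.descFactorial Q.card : F) := by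
  rw [phi_congr (b' := fun _ _ => 1) fun i hi l _ => hb i hi l]
  clear hb
  induction Q using Finset.induction_on with
  | empty => simp [phi_no_cols]
  | insert k Q hk ih =>
    rw [card_insert_of_notMem hk] at hQ
    rw [phi_insert_ones _ (by simp) hk, ih (by omega), card_insert_of_notMem hk,
      Nat.descFactorial_succ, Nat.cast_mul, Nat.cast_sub (by omega)]

/-- Rows over `A` can be added to rows of ones without making `phi` vanish. -/
lemma exists_phi_ne_zero {A : Finset F} (h1 : 1 ∈ A) (hA : 2 ≤ A.card) {s₀ : Finset ι}
    (hs₀ : ((s₀.card.factorial : ℕ) : F) ≠ 0) (s : Finset ι) (hs : Disjoint s₀ s) (Q : Finset L)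
    (hQ : Q.card = s₀.card + s.card) :
    ∃ b : ι → L → F, (∀ i l, b i l ∈ A) ∧ (∀ i ∈ s₀, ∀ l, b i l = 1) ∧ phi b Q (s₀ ∪ s) ≠ 0 := by
  induction s using Finset.induction_on generalizing Q with
  | empty =>
    refine ⟨fun _ _ => 1, fun _ _ => h1, fun _ _ _ => rfl, ?_⟩
    rw [card_empty, add_zero] at hQ
    rw [union_empty, phi_ones (by simp) hQ.le, hQ, Nat.descFactorial_self]
    exact hs₀
  | insert j s hj ih =>
    rw [card_insert_of_notMem hj] at hQ
    rw [disjoint_insert_right] at hs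
    obtain ⟨l, hl⟩ : Q.Nonempty := by rw [← card_pos]; omega
    obtain ⟨b, hbA, hb1, hb⟩ := ih hs.2 (Q.erase l) (by rw [card_erase_of_mem hl]; omega)
    have hj' : j ∉ s₀ ∪ s := by simp [hs.1, hj]
    let b' : F → ι → L → F := fun a => Function.update b j (Function.update (fun _ => 1) l a)
    have hb' : ∀ a i, i ≠ j → b' a i = b i := fun a i hi => Function.update_of_ne hi _ _
    have hval : ∀ a, phi (b' a) Q (insert j (s₀ ∪ s)) =
        (phi b Q (s₀ ∪ s) + ∑ l' ∈ Q.erase l, phi b (Q.erase l') (s₀ ∪ s)) +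
          a * phi b (Q.erase l) (s₀ ∪ s) := by
      intro a
      have hrest : ∀ Q', phi (b' a) Q' (s₀ ∪ s) = phi b Q' (s₀ ∪ s) := fun Q' =>
        phi_congr fun i hi l _ => by rw [hb' a i (fun h => hj' (h ▸ hi))]
      rw [phi_insert _ _ hj', hrest, ← add_sum_erase Q _ hl, hrest]
      have : ∀ l' ∈ Q.erase l, b' a j l' * phi (b' a) (Q.erase l') (s₀ ∪ s) =
          phi b (Q.erase l') (s₀ ∪ s) := by
        intro l' hl'
        simp [hrest, b', Function.update_of_ne (ne_of_mem_erase hl')]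
      rw [sum_congr rfl this]
      simp only [b', Function.update_self]
      ring
    obtain ⟨a, ha, hne⟩ : ∃ a ∈ A, phi (b' a) Q (insert j (s₀ ∪ s)) ≠ 0 := by
      obtain ⟨a₁, ha₁, a₂, ha₂, hne⟩ := one_lt_card.1 hA
      by_contra! h
      have e₁ := h a₁ ha₁
      have e₂ := h a₂ ha₂
      rw [hval] at e₁ e₂
      exact hne (mul_right_cancel₀ hb (add_left_cancel (e₁.trans e₂.symm)))
    refine ⟨b' a, fun i l' => ?_, fun i hi l' => ?_, by rwa [union_insert]⟩
    · by_cases hij : i = j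
      · subst hij
        simp only [b', Function.update_self, Function.update_apply]
        split_ifs <;> assumption
      · rw [hb' a i hij]; exact hbA i l'
    · rw [hb' a i (fun h => hs.1 (h ▸ hi))]; exact hb1 i hi l'

variable {p : ℕ} [Fact p.Prime]

lemma min_le_card_image_sum [Fintype ι] {A : Finset (ZMod p)} (hA : A.Nonempty) (S : Finset ι) :
    min p (S.card * (A.card - 1) + 1) ≤
      ((Fintype.piFinset fun _ : ι => A).image fun β => ∑ i ∈ S, β i).card := by
  have hne : (Fintype.piFinset fun _ : ι => A).Nonempty := Fintype.piFinset_nonempty.2 fun _ => hA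
  induction S using Finset.induction_on with
  | empty => simp [hne]
  | insert i S hi ih =>
    have hsub : A + ((Fintype.piFinset fun _ : ι => A).image fun β => ∑ i ∈ S, β i) ⊆
        (Fintype.piFinset fun _ : ι => A).image fun β => ∑ i ∈ insert i S, β i := by
      intro x hx
      obtain ⟨a, ha, _, hy, rfl⟩ := mem_add.1 hx
      obtain ⟨β, hβ, rfl⟩ := mem_image.1 hy
      refine mem_image.2 ⟨Function.update β i a, ?_, ?_⟩
      · rw [Fintype.mem_piFinset] at hβ ⊢
        intro j
        rw [Function.update_apply]
        split_ifs
        exacts [ha, hβ j]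
      · rw [sum_insert hi, Function.update_self]
        congr 1
        exact sum_congr rfl fun j hj =>
          Function.update_of_ne (ne_of_mem_of_not_mem hj hi) _ _
    refine le_trans ?_ ((ZMod.cauchy_davenport Fact.out hA (hne.image _)).trans
      (card_le_card hsub))
    rw [card_insert_of_notMem hi, Nat.add_mul]
    have := hA.card_pos
    generalize S.card * (A.card - 1) = x at *
    omega

lemma min_le_ncard_permSet {A : Finset (ZMod p)} (h1 : 1 ∈ A) (hA : 2 ≤ A.card) {n : ℕ}
    (hn : 1 ≤ n) : min p (n * (A.card - 1) + 1) ≤ (permSet n A).ncard := by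
  classical
  obtain ⟨n, rfl⟩ : ∃ m, n = m + 1 := ⟨n - 1, by omega⟩
  have hp : p.Prime := Fact.out
  obtain ⟨S, -, hS⟩ := exists_subset_card_eq (s := (univ : Finset (Fin (n + 1))))
    (n := min (n + 1) p) (by simp)
  have hS1 : 1 ≤ S.card := by have := hp.pos; omega
  obtain ⟨j₀, hj₀⟩ : S.Nonempty := card_pos.1 hS1
  have hun : S.erase j₀ ∪ Sᶜ = univ.erase j₀ := by
    ext i
    by_cases hi : i = j₀ <;> by_cases hiS : i ∈ S <;> simp_all
  obtain ⟨b, hbA, hb1, hb⟩ := exists_phi_ne_zero h1 hA (s₀ := S.erase j₀)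
    (by
      rw [card_erase_of_mem hj₀, Ne, ZMod.natCast_eq_zero_iff, hp.dvd_factorial]
      omega) Sᶜ
    (disjoint_compl_right.mono_left (erase_subset _ _)) (univ.erase (0 : Fin (n + 1)))
    (by
      rw [card_erase_of_mem hj₀, card_compl, card_erase_of_mem (mem_univ _)]
      have := card_le_univ S
      simp at this ⊢
      omega)
  rw [hun] at hb
  let M : (Fin (n + 1) → ZMod p) → Fin (n + 1) → Fin (n + 1) → ZMod p := fun β i l =>
    if l = 0 then (if i ∈ S then β i else 1) else if i ∈ S then 1 else b i l
  have hM1 : ∀ β, ∀ i ∈ S, ∀ l, l ≠ 0 → M β i l = 1 := fun β i hi l hl => by simp [M, hi, hl]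
  have hM2 : ∀ β i, i ∈ univ.erase j₀ → ∀ l ∈ univ.erase (0 : Fin (n + 1)), M β i l = b i l := by
    intro β i hi l hl
    by_cases hiS : i ∈ S
    · rw [hM1 β i hiS l (ne_of_mem_erase hl),
        hb1 i (mem_erase.2 ⟨ne_of_mem_erase hi, hiS⟩)]
    · simp [M, hiS, ne_of_mem_erase hl]
  set c := phi b (univ.erase (0 : Fin (n + 1))) (univ.erase j₀) with hc
  have hcoef : ∀ β, ∀ i ∈ S, phi (M β) (univ.erase 0) (univ.erase i) = c := by
    intro β i hi
    have h := phi_map (M β) (Equiv.swap i j₀).toEmbedding (Function.Embedding.refl _)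
      (univ.erase 0) (univ.erase j₀)
    rw [map_refl, map_erase, map_univ_equiv] at h
    simp only [Equiv.coe_toEmbedding, Equiv.swap_apply_right] at h
    rw [h, hc]
    refine phi_congr fun i' hi' l hl => ?_
    rw [← hM2 β i' hi' l hl]
    by_cases h' : i' = i
    · subst h'
      simp [hM1 β _ hj₀ l (ne_of_mem_erase hl), hM1 β _ hi l (ne_of_mem_erase hl)]
    · rw [Equiv.swap_apply_of_ne_of_ne h' (ne_of_mem_erase hi')]
      rfl
  obtain ⟨e, he⟩ : ∃ e, ∀ β, phi (M β) univ univ = e + c * ∑ i ∈ S, β i := by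
    refine ⟨∑ i ∈ Sᶜ, phi (M 0) (univ.erase 0) (univ.erase i), fun β => ?_⟩
    have h := phi_insert_col (M β) (notMem_erase (0 : Fin (n + 1)) univ) univ
    rw [insert_erase (mem_univ _)] at h
    rw [h, ← sum_add_sum_compl S, add_comm]
    congr 1
    · refine sum_congr rfl fun i hi => ?_
      have h0 : M β i 0 = 1 := by simp [M, mem_compl.1 hi]
      rw [h0, one_mul]
      refine phi_congr fun i' _ l hl => ?_
      simp [M, ne_of_mem_erase hl]
    · rw [mul_sum]
      refine sum_congr rfl fun i hi => ?_
      rw [hcoef β i hi, mul_comm]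
      simp [M, hi]
  have hsub : (fun x => e + c * x) ''
      ((Fintype.piFinset fun _ : Fin (n + 1) => A).image fun β => ∑ i ∈ S, β i :
      Finset (ZMod p)) ⊆ permSet (n + 1) A := by
    rintro _ ⟨_, hx, rfl⟩
    obtain ⟨β, hβ, rfl⟩ := mem_image.1 hx
    rw [Fintype.mem_piFinset] at hβ
    have := factorial_mul_phi_mem_permSet (n := n + 1) (b := M β) h1 (by simp) (by simp)
      (fun i l => by
        simp only [M]
        split_ifs
        exacts [hβ i, h1, h1, hbA i l])
    simpa [he] using this
  have hinj : Function.Injective fun x => e + c * x := fun x y hxy =>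
    mul_left_cancel₀ hb (add_left_cancel hxy)
  have h := Set.ncard_le_ncard hsub (Set.toFinite _)
  rw [Set.ncard_image_of_injective _ hinj, Set.ncard_coe_finset] at h
  refine le_trans ?_ ((min_le_card_image_sum (card_pos.1 (by omega)) S).trans h)
  rw [hS]
  rcases le_total (n + 1) p with hnp | hnp
  · rw [min_eq_left hnp]
  · rw [min_eq_right hnp]
    have : p * 1 ≤ p * (A.card - 1) := Nat.mul_le_mul_left p (by omega)
    omega

end CauchyDavenport

section SumProduct

open Finset

open Classical in
/-- The set of all linear combinations `∑ β i • c i` with coefficients `β i` in `A`. -/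
noncomputable def dilateSum {F ι V : Type*} [Field F] [Fintype ι] [AddCommGroup V] [Module F V]
    (A : Finset F) (c : ι → V) : Finset V :=
  (Fintype.piFinset fun _ : ι => A).image fun β => ∑ i, β i • c i

lemma mem_dilateSum {F ι V : Type*} [Field F] [Fintype ι] [AddCommGroup V] [Module F V]
    {A : Finset F} {c : ι → V} {x : V} :
    x ∈ dilateSum A c ↔ ∃ β : ι → F, (∀ i, β i ∈ A) ∧ ∑ i, β i • c i = x := by
  simp [dilateSum]

lemma dilateSum_nonempty {F ι V : Type*} [Field F] [Fintype ι] [AddCommGroup V] [Module F V]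
    {A : Finset F} (hA : A.Nonempty) (c : ι → V) : (dilateSum A c).Nonempty := by
  obtain ⟨a, ha⟩ := hA
  exact ⟨_, mem_dilateSum.2 ⟨fun _ => a, fun _ => ha, rfl⟩⟩

/-- `d` is a product of `m` differences of elements of `A`. -/
def IsDiffProd {F : Type*} [Field F] (A : Finset F) (m : ℕ) (d : F) : Prop :=
  ∃ y y' : Fin m → F, (∀ l, y l ∈ A) ∧ (∀ l, y' l ∈ A) ∧ d = ∏ l, (y l - y' l)

lemma IsDiffProd.sub_mul {F : Type*} [Field F] {A : Finset F} {m : ℕ} {d a a' : F}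
    (h : IsDiffProd A m d) (ha : a ∈ A) (ha' : a' ∈ A) : IsDiffProd A (m + 1) ((a - a') * d) := by
  obtain ⟨y, y', hy, hy', rfl⟩ := h
  refine ⟨Fin.cons a y, Fin.cons a' y', Fin.cases ha hy, Fin.cases ha' hy', ?_⟩
  simp [Fin.prod_univ_succ]

lemma exists_isDiffProd_ne_zero {F : Type*} [Field F] {A : Finset F} (hA : 2 ≤ A.card) (m : ℕ) :
    ∃ d, IsDiffProd A m d ∧ d ≠ 0 := by
  obtain ⟨a, ha, a', ha', hne⟩ := one_lt_card.1 hA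
  exact ⟨_, ⟨fun _ => a, fun _ => a', fun _ => ha, fun _ => ha', rfl⟩,
    prod_ne_zero_iff.2 fun _ _ => sub_ne_zero.2 hne⟩

variable {p : ℕ} [Fact p.Prime]

lemma sq_card_le_card_image_mul {α β : Type*} [DecidableEq β] (E : Finset α) (f : α → β) :
    E.card ^ 2 ≤ (E.image f).card * ((E ×ˢ E).filter fun e => f e.1 = f e.2).card := by
  have h1 : E.card = ∑ i ∈ E.image f, (E.filter fun e => f e = i).card :=
    card_eq_sum_card_image f E
  have h2 : ((E ×ˢ E).filter fun e => f e.1 = f e.2).card =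
      ∑ i ∈ E.image f, (E.filter fun e => f e = i).card ^ 2 := by
    rw [card_eq_sum_card_fiberwise (f := fun e => f e.1) (t := E.image f)]
    · refine sum_congr rfl fun i _ => ?_
      rw [sq, ← card_product]
      congr 1
      ext ⟨x, y⟩
      simp only [mem_filter, mem_product]
      constructor
      · rintro ⟨⟨⟨hx, hy⟩, h⟩, h'⟩; exact ⟨⟨hx, h'⟩, hy, h ▸ h'⟩
      · rintro ⟨⟨hx, h⟩, hy, h'⟩; exact ⟨⟨⟨hx, hy⟩, h.trans h'.symm⟩, h⟩
    · intro e he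
      simp only [coe_filter, mem_product, Set.mem_ofPred_eq] at he
      exact mem_image_of_mem _ he.1.1
  rw [h2]
  conv_lhs => rw [h1]
  exact sq_sum_le_card_mul_sum_sq

/-- Among the projections in directions `t ∈ T` of a planar set, one is large. -/
lemma exists_large_projection {E : Finset (ZMod p × ZMod p)} (hE : E.Nonempty)
    {T : Finset (ZMod p)} (hT : T.Nonempty) :
    ∃ t ∈ T, (1 : ℝ) / (E.image fun e => e.1 + t * e.2).card ≤
      1 / p + p / (E.card * T.card) := by
  have hp : (0 : ℝ) < p := by exact_mod_cast (Fact.out : p.Prime).pos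
  have hE' : (0 : ℝ) < E.card := by exact_mod_cast hE.card_pos
  have hT' : (0 : ℝ) < T.card := by exact_mod_cast hT.card_pos
  set C : ZMod p → ℕ := fun t =>
    ((E ×ˢ E).filter fun e => e.1.1 + t * e.1.2 = e.2.1 + t * e.2.2).card with hC
  have hCS : ∀ t, (E.card : ℝ) ^ 2 ≤ (E.image fun e => e.1 + t * e.2).card * C t := fun t => by
    exact_mod_cast sq_card_le_card_image_mul E fun e => e.1 + t * e.2
  have hlow : ∀ t, (E.card : ℝ) ^ 2 / p ≤ C t := fun t => by
    rw [div_le_iff₀ hp, mul_comm]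
    refine (hCS t).trans ?_
    gcongr
    simpa using card_le_univ (E.image fun e => e.1 + t * e.2)
  have hsum : ∑ t, (C t : ℝ) ≤ p * E.card + E.card ^ 2 := by
    have : ∑ t, C t ≤ p * E.card + E.card ^ 2 := by
      simp only [hC, card_filter]
      rw [sum_comm]
      have hle : ∀ e ∈ E ×ˢ E,
          ∑ t : ZMod p, (if e.1.1 + t * e.1.2 = e.2.1 + t * e.2.2 then 1 else 0) ≤
            (if e.1 = e.2 then p else 0) + 1 := by
        rintro ⟨e, e'⟩ -
        rw [← card_filter]
        split_ifs with h
        · refine (card_le_univ _).trans ?_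
          simp
        · rw [zero_add, card_le_one]
          intro t ht t' ht'
          simp only [mem_filter, mem_univ, true_and] at ht ht'
          by_contra hne
          have h2 : (t - t') * (e.2 - e'.2) = 0 := by linear_combination ht - ht'
          rcases mul_eq_zero.1 h2 with h3 | h3
          · exact hne (sub_eq_zero.1 h3)
          · rw [sub_eq_zero] at h3
            rw [h3] at ht
            exact h (Prod.ext (add_right_cancel ht) h3)
      refine (sum_le_sum hle).trans ?_
      rw [sum_add_distrib, sum_product]
      simp [sq, mul_comm]
    exact_mod_cast this
  have hTsum : ∑ t ∈ T, (C t : ℝ) ≤ ∑ t ∈ T, (p * E.card / T.card + E.card ^ 2 / p : ℝ) := by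
    rw [← sum_add_sum_compl T] at hsum
    have hc : ∑ t ∈ Tᶜ, ((E.card : ℝ) ^ 2 / p) ≤ ∑ t ∈ Tᶜ, (C t : ℝ) :=
      sum_le_sum fun t _ => hlow t
    rw [sum_const, card_compl, nsmul_eq_mul, ZMod.card, Nat.cast_sub (by
      simpa using card_le_univ T)] at hc
    rw [sum_const, nsmul_eq_mul]
    have h1 : ((p : ℝ) - T.card) * (E.card ^ 2 / p) = E.card ^ 2 - T.card * (E.card ^ 2 / p) := by
      field_simp
    have h2 : (T.card : ℝ) * (p * E.card / T.card + E.card ^ 2 / p) =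
        p * E.card + T.card * (E.card ^ 2 / p) := by
      field_simp
    linarith
  obtain ⟨t, ht, htC⟩ := exists_le_of_sum_le hT hTsum
  refine ⟨t, ht, ?_⟩
  have hI : (0 : ℝ) < (E.image fun e => e.1 + t * e.2).card := by
    exact_mod_cast (hE.image _).card_pos
  calc (1 : ℝ) / (E.image fun e => e.1 + t * e.2).card ≤ C t / E.card ^ 2 := by
        rw [div_le_div_iff₀ hI (by positivity), one_mul, mul_comm]
        exact hCS t
    _ ≤ (p * E.card / T.card + E.card ^ 2 / p) / E.card ^ 2 := by gcongr
    _ = 1 / p + p / (E.card * T.card) := by field_simp; ring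

/-- A fibring step in the style of Glibichuk and Konyagin. -/
lemma exists_fibring {A X : Finset (ZMod p)} (hA : 2 ≤ A.card) (hX : X.Nonempty) {g : ZMod p}
    (hg : g ≠ 0) :
    ∃ x ∈ X, ∃ x' ∈ X, ∃ a ∈ A, ∃ a' ∈ A, a ≠ a' ∧ ∃ ξ τ : ZMod p,
      (1 : ℝ) / ((X ×ˢ A).image fun e => e.1 + ξ * e.2).card ≤ 1 / p + 1 / (X.card * A.card) ∧
      ∀ b ∈ A, ∃ w ∈ A, (a - a') * (ξ * b) + τ = (x - x') * b + w * ((a - a') * g) := by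
  have hp : (0 : ℝ) < p := by exact_mod_cast (Fact.out : p.Prime).pos
  let R : ZMod p → Prop := fun r =>
    ∃ x ∈ X, ∃ x' ∈ X, ∃ a ∈ A, ∃ a' ∈ A, a ≠ a' ∧ (a - a') * r = x - x'
  by_cases hR : ∀ r, R r → R (r + g)
  · obtain ⟨ξ, -, hξ⟩ := exists_large_projection (E := X ×ˢ A)
      (hX.product (card_pos.1 (by omega))) (T := univ) univ_nonempty
    have hRξ : R ξ := by
      have h0 : R 0 := by
        obtain ⟨x, hx⟩ := hX
        obtain ⟨a, ha, a', ha', hne⟩ := one_lt_card.1 hA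
        exact ⟨x, hx, x, hx, a, ha, a', ha', hne, by simp⟩
      have hk : ∀ k : ℕ, R (k * g) := fun k => by
        induction k with
        | zero => simpa using h0
        | succ k ih => have := hR _ ih; push_cast; rwa [add_mul, one_mul]
      have := hk (ξ / g).val
      rwa [ZMod.natCast_zmod_val, div_mul_cancel₀ _ hg] at this
    obtain ⟨x, hx, x', hx', a, ha, a', ha', hne, h⟩ := hRξ
    refine ⟨x, hx, x', hx', a, ha, a', ha', hne, ξ, a * ((a - a') * g), ?_, fun b _ =>
      ⟨a, ha, by linear_combination b * h⟩⟩
    rw [card_product, card_univ, ZMod.card] at hξ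
    refine hξ.trans_eq ?_
    push_cast
    have : (0 : ℝ) < X.card := by exact_mod_cast hX.card_pos
    have : (0 : ℝ) < A.card := by exact_mod_cast (by omega : 0 < A.card)
    field_simp
  · push Not at hR
    obtain ⟨r, ⟨x, hx, x', hx', a, ha, a', ha', hne, h⟩, hrg⟩ := hR
    refine ⟨x, hx, x', hx', a, ha, a', ha', hne, r + g, 0, ?_, fun b hb =>
      ⟨b, hb, by linear_combination b * h⟩⟩
    rw [card_image_of_injOn, card_product]
    · push_cast
      have : (0 : ℝ) ≤ 1 / p := by positivity
      linarith
    · rintro ⟨x₁, b₁⟩ h₁ ⟨x₂, b₂⟩ h₂ h12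
      simp only [coe_product, Set.mem_prod, mem_coe] at h₁ h₂ h12
      by_cases hb : b₁ = b₂
      · subst hb; simpa using h12
      · exact absurd ⟨x₂, h₂.1, x₁, h₁.1, b₁, h₁.2, b₂, h₂.2, hb, by linear_combination h12⟩ hrg

/-- Linear combinations with coefficients in `A` of few products of differences of `A` fill a
large part of the field. -/
theorem exists_large_dilateSum {A : Finset (ZMod p)} (hA : 2 ≤ A.card) (m : ℕ) :
    ∃ (ι : Type) (_ : Fintype ι) (d : ι → ZMod p), Fintype.card ι + 1 = 2 ^ (m + 1) ∧
      (∀ i, IsDiffProd A m (d i)) ∧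
      (1 : ℝ) / (dilateSum A d).card ≤ 1 / (A.card : ℝ) ^ (m + 1) + 2 / p := by
  have hp : (0 : ℝ) < p := by exact_mod_cast (Fact.out : p.Prime).pos
  have hA2 : (2 : ℝ) ≤ A.card := by exact_mod_cast hA
  have hA0 : (0 : ℝ) < A.card := by linarith
  have hAne : A.Nonempty := card_pos.1 (by omega)
  induction m with
  | zero =>
    refine ⟨Unit, inferInstance, fun _ => 1, by simp, fun _ => ⟨0, 0, by simp, by simp, by simp⟩, ?_⟩
    have : dilateSum A (fun _ : Unit => (1 : ZMod p)) = A := by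
      ext x
      simp only [mem_dilateSum, univ_unique, sum_singleton, smul_eq_mul, mul_one]
      exact ⟨fun ⟨β, h, h'⟩ => h' ▸ h _, fun h => ⟨fun _ => x, fun _ => h, rfl⟩⟩
    rw [this]
    have : (0 : ℝ) ≤ 2 / p := by positivity
    simpa using this
  | succ m ih =>
    obtain ⟨ι, _, d, hcard, hd, hX⟩ := ih
    obtain ⟨g, hg, hg0⟩ := exists_isDiffProd_ne_zero hA m
    obtain ⟨x, hx, x', hx', a, ha, a', ha', hne, ξ, τ, hξ, hτ⟩ :=
      exists_fibring hA (dilateSum_nonempty hAne d) hg0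
    obtain ⟨y, hy, rfl⟩ := mem_dilateSum.1 hx
    obtain ⟨y', hy', rfl⟩ := mem_dilateSum.1 hx'
    refine ⟨(ι ⊕ ι) ⊕ Unit, inferInstance, Sum.elim (Sum.elim (fun i => (a - a') * d i)
      fun i => (y i - y' i) * d i) fun _ => (a - a') * g, ?_, ?_, ?_⟩
    · simp only [Fintype.card_sum, Fintype.card_unit]
      rw [pow_succ]; omega
    · rintro ((i | i) | i)
      exacts [(hd i).sub_mul ha ha', (hd i).sub_mul (hy i) (hy' i), hg.sub_mul ha ha']
    · set D := dilateSum A (Sum.elim (Sum.elim (fun i => (a - a') * d i)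
        fun i => (y i - y' i) * d i) fun _ : Unit => (a - a') * g) with hD
      have hsub : ((dilateSum A d ×ˢ A).image fun e => e.1 + ξ * e.2).image
          (fun u => (a - a') * u + τ) ⊆ D := by
        intro u hu
        obtain ⟨_, hv, rfl⟩ := mem_image.1 hu
        obtain ⟨⟨v, b⟩, hvb, rfl⟩ := mem_image.1 hv
        obtain ⟨hv, hb⟩ := mem_product.1 hvb
        obtain ⟨β, hβ, rfl⟩ := mem_dilateSum.1 hv
        obtain ⟨w, hw, hwb⟩ := hτ b hb
        refine mem_dilateSum.2 ⟨Sum.elim (Sum.elim β fun _ => b) fun _ => w, ?_, ?_⟩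
        · rintro ((i | i) | i)
          exacts [hβ i, hb, hw]
        · simp only [Fintype.sum_sum_type, Sum.elim_inl, Sum.elim_inr, univ_unique,
            sum_singleton, smul_eq_mul]
          simp only [smul_eq_mul, ← sum_sub_distrib] at hwb
          have e1 : ∑ i, β i * ((a - a') * d i) = (a - a') * ∑ i, β i * d i := by
            rw [mul_sum]; exact sum_congr rfl fun i _ => by ring
          have e2 : ∑ i, b * ((y i - y' i) * d i) = (∑ i, (y i * d i - y' i * d i)) * b := by
            rw [sum_mul]; exact sum_congr rfl fun i _ => by ring
          rw [e1, e2]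
          linear_combination -hwb
      have hle := card_le_card hsub
      rw [card_image_of_injective _ fun u v huv =>
        mul_left_cancel₀ (sub_ne_zero.2 hne) (add_right_cancel huv)] at hle
      have hI : (0 : ℝ) < ((dilateSum A d ×ˢ A).image fun e => e.1 + ξ * e.2).card := by
        exact_mod_cast (((dilateSum_nonempty hAne d).product hAne).image _).card_pos
      have hX0 : (0 : ℝ) < (dilateSum A d).card := by
        exact_mod_cast (dilateSum_nonempty hAne d).card_pos
      calc (1 : ℝ) / D.card
          ≤ 1 / ((dilateSum A d ×ˢ A).image fun e => e.1 + ξ * e.2).card :=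
            one_div_le_one_div_of_le hI (by exact_mod_cast hle)
        _ ≤ 1 / p + 1 / ((dilateSum A d).card * A.card) := hξ
        _ = 1 / p + 1 / (dilateSum A d).card / A.card := by rw [div_div]
        _ ≤ 1 / p + (1 / (A.card : ℝ) ^ (m + 1) + 2 / p) / A.card := by gcongr
        _ = 1 / p + 1 / (A.card : ℝ) ^ (m + 1 + 1) + 2 / p / A.card := by
            rw [pow_succ (A.card : ℝ) (m + 1)]; field_simp; ring
        _ ≤ 1 / p + 1 / (A.card : ℝ) ^ (m + 1 + 1) + 2 / p / 2 := by gcongr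
        _ = 1 / (A.card : ℝ) ^ (m + 1 + 1) + 2 / p := by ring

end SumProduct

section RowRecursion

open Finset

variable {F L : Type*} [Field F]

lemma sum_powerset_neg_one_pow_mul (Q : Finset L) (hQ : Q.Nonempty) (x : F) :
    ∑ S ∈ Q.powerset, (-1) ^ S.card * x = 0 := by
  rw [← sum_mul]
  have := sum_powerset_neg_one_pow_card_of_nonempty hQ
  have h2 : ((∑ S ∈ Q.powerset, (-1) ^ S.card : ℤ) : F) = 0 := by rw [this]; simp
  push_cast at h2
  rw [h2, zero_mul]

variable [DecidableEq L]

/-- The solution `ψ` of the recursion `ψ Q = T Q - ∑_{l ∈ Q} y l * ψ (Q \ {l})`. -/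
noncomputable def psi (T : Finset L → F) (y : L → F) (Q : Finset L) : F :=
  T Q - ∑ l ∈ Q.attach, y l * psi T y (Q.erase l)
termination_by Q.card
decreasing_by exact card_erase_lt_of_mem l.2

lemma psi_eq (T : Finset L → F) (y : L → F) (Q : Finset L) :
    psi T y Q = T Q - ∑ l ∈ Q, y l * psi T y (Q.erase l) := by
  rw [psi, sum_attach Q fun l => y l * psi T y (Q.erase l)]

lemma psi_empty (T : Finset L → F) (y : L → F) : psi T y ∅ = T ∅ := by
  rw [psi_eq, sum_empty, sub_zero]

lemma psi_singleton (T : Finset L → F) (y : L → F) (k : L) :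
    psi T y {k} = T {k} - y k * T ∅ := by
  rw [psi_eq, sum_singleton, erase_singleton, psi_empty]

lemma eq_psi {T c : Finset L → F} {y : L → F}
    (hc : ∀ Q, c Q = T Q - ∑ l ∈ Q, y l * c (Q.erase l)) (Q : Finset L) : c Q = psi T y Q := by
  induction Q using Finset.strongInduction with
  | H Q ih =>
    rw [hc, psi_eq]
    congr 1
    exact sum_congr rfl fun l hl => by rw [ih _ (erase_ssubset hl)]

lemma psi_congr {T : Finset L → F} {y y' : L → F} {Q : Finset L} (h : ∀ l ∈ Q, y l = y' l) :
    psi T y Q = psi T y' Q := by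
  induction Q using Finset.strongInduction with
  | H Q ih =>
    rw [psi_eq, psi_eq T y']
    congr 1
    exact sum_congr rfl fun l hl => by
      rw [ih _ (erase_ssubset hl) fun l' hl' => h l' (mem_of_mem_erase hl'), h l hl]

lemma psi_add_mul (T G : Finset L → F) (t : F) (y : L → F) (Q : Finset L) :
    psi (fun Q => T Q + t * G Q) y Q = psi T y Q + t * psi G y Q := by
  refine (eq_psi (c := fun Q => psi T y Q + t * psi G y Q) (fun Q => ?_) Q).symm
  simp only [mul_add, sum_add_distrib]
  rw [psi_eq T, psi_eq G, mul_sub, mul_sum]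
  have : ∀ l ∈ Q, t * (y l * psi G y (Q.erase l)) = y l * (t * psi G y (Q.erase l)) :=
    fun l _ => by ring
  rw [sum_congr rfl this]
  ring

/-- The row that agrees with `y'` on `S` and with `y` elsewhere. -/
def mixRow (y y' : L → F) (S : Finset L) (l : L) : F := if l ∈ S then y' l else y l

lemma psi_mixRow_insert (T : Finset L → F) (y y' : L → F) {Q : Finset L} {l : L} (hl : l ∉ Q)
    (S : Finset L) : psi T (mixRow y y' (insert l S)) Q = psi T (mixRow y y' S) Q :=
  psi_congr fun l' hl' => by
    have : l' ≠ l := fun h => hl (h ▸ hl')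
    simp [mixRow, this]

lemma sum_powerset_mixRow_mul (T : Finset L → F) (y y' : L → F) {Q R : Finset L} {l : L}
    (hl : l ∈ Q) (hlR : l ∉ R) :
    ∑ S ∈ Q.powerset, (-1) ^ S.card * (mixRow y y' S l * psi T (mixRow y y' S) R) =
      (y l - y' l) * ∑ S ∈ (Q.erase l).powerset, (-1) ^ S.card * psi T (mixRow y y' S) R := by
  conv_lhs => rw [← insert_erase hl]
  rw [sum_powerset_insert (notMem_erase l Q), ← sum_add_distrib, mul_sum]
  refine sum_congr rfl fun S hS => ?_
  have hlS : l ∉ S := fun h => notMem_erase l Q (mem_powerset.1 hS h)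
  rw [psi_mixRow_insert T y y' hlR, card_insert_of_notMem hlS, pow_succ]
  simp only [mixRow, hlS, mem_insert_self, if_true, if_false]
  ring

lemma sum_powerset_psi_mixRow (T : Finset L → F) (y y' : L → F) (Q : Finset L) :
    ∑ S ∈ Q.powerset, (-1) ^ S.card * psi T (mixRow y y' S) Q =
      (-1) ^ Q.card * (Q.card.factorial : F) * T ∅ * ∏ l ∈ Q, (y l - y' l) := by
  induction Q using Finset.strongInduction with
  | H Q ih =>
    rcases Q.eq_empty_or_nonempty with rfl | hQ
    · simp [psi_empty]
    rw [sum_congr rfl fun S _ =>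
      congrArg ((-1) ^ S.card * ·) (psi_eq T (mixRow y y' S) Q)]
    simp_rw [mul_sub, sum_sub_distrib, mul_sum]
    rw [sum_powerset_neg_one_pow_mul Q hQ, sum_comm]
    have : ∀ l ∈ Q, ∑ S ∈ Q.powerset,
        (-1) ^ S.card * (mixRow y y' S l * psi T (mixRow y y' S) (Q.erase l)) =
          (-1) ^ (Q.card - 1) * ((Q.card - 1).factorial : F) * T ∅ * ∏ l ∈ Q, (y l - y' l) := by
      intro l hl
      rw [sum_powerset_mixRow_mul T y y' hl (notMem_erase l Q), ih _ (erase_ssubset hl),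
        card_erase_of_mem hl, ← mul_prod_erase Q _ hl]
      ring
    rw [sum_congr rfl this, sum_const, nsmul_eq_mul]
    obtain ⟨k, hk⟩ : ∃ k, Q.card = k + 1 := ⟨Q.card - 1, by have := hQ.card_pos; omega⟩
    rw [hk, add_tsub_cancel_right, Nat.factorial_succ]
    push_cast
    ring

lemma sum_powerset_psi_mixRow_insert (T : Finset L → F) (y y' : L → F) {k : L} {Q : Finset L}
    (hk : k ∉ Q) :
    ∑ S ∈ Q.powerset, (-1) ^ S.card * psi T (mixRow y y' S) (insert k Q) =
      (-1) ^ Q.card * (Q.card.factorial : F) * (T {k} - (Q.card + 1) * y k * T ∅) *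
        ∏ l ∈ Q, (y l - y' l) := by
  induction Q using Finset.strongInduction with
  | H Q ih =>
    rcases Q.eq_empty_or_nonempty with rfl | hQ
    · simp [psi_singleton, mixRow]
    rw [sum_congr rfl fun S _ =>
      congrArg ((-1) ^ S.card * ·) (psi_eq T (mixRow y y' S) (insert k Q))]
    simp_rw [mul_sub, sum_sub_distrib, sum_insert hk, mul_add,
      sum_add_distrib, mul_sum, erase_insert hk]
    rw [sum_powerset_neg_one_pow_mul Q hQ, sum_comm (s := Q.powerset)]
    have h1 : ∑ S ∈ Q.powerset, (-1) ^ S.card * (mixRow y y' S k * psi T (mixRow y y' S) Q) =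
        y k * ((-1) ^ Q.card * (Q.card.factorial : F) * T ∅ * ∏ l ∈ Q, (y l - y' l)) := by
      rw [← sum_powerset_psi_mixRow, mul_sum]
      refine sum_congr rfl fun S hS => ?_
      have : k ∉ S := fun h => hk (mem_powerset.1 hS h)
      simp only [mixRow, this, if_false]
      ring
    have : ∀ l ∈ Q, ∑ S ∈ Q.powerset,
        (-1) ^ S.card * (mixRow y y' S l * psi T (mixRow y y' S) ((insert k Q).erase l)) =
          (-1) ^ (Q.card - 1) * ((Q.card - 1).factorial : F) *
            (T {k} - Q.card * y k * T ∅) * ∏ l ∈ Q, (y l - y' l) := by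
      intro l hl
      have hkl : k ≠ l := fun h => hk (h ▸ hl)
      rw [sum_powerset_mixRow_mul T y y' hl (notMem_erase l _), erase_insert_of_ne hkl,
        ih _ (erase_ssubset hl) (by simp [hk]), card_erase_of_mem hl, ← mul_prod_erase Q _ hl]
      have : ((Q.card - 1 : ℕ) : F) + 1 = Q.card := by
        rw [Nat.cast_sub hQ.card_pos]; simp
      rw [this]
      ring
    rw [h1, sum_congr rfl this, sum_const, nsmul_eq_mul]
    obtain ⟨r, hr⟩ : ∃ r, Q.card = r + 1 := ⟨Q.card - 1, by have := hQ.card_pos; omega⟩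
    rw [hr, add_tsub_cancel_right, Nat.factorial_succ]
    push_cast
    ring

end RowRecursion

section Ruzsa

open Finset Pointwise

lemma card_sub_mul_card_le {G : Type*} [AddCommGroup G] [DecidableEq G] {X Y : Finset G}
    (hX : X.Nonempty) (hY : Y.Nonempty) (E : Finset G) :
    (X - Y).card * E.card ≤ (E + X + Y).card ^ 2 := by
  refine (ruzsa_triangle_inequality_sub_add_add X E Y).trans ?_
  rw [sq]
  refine Nat.mul_le_mul ?_ ?_
  · rw [add_comm X]
    exact card_le_card_add_right hY
  · rw [add_comm Y, add_right_comm]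
    exact card_le_card_add_right hX

variable {F J U V : Type*} [Field F] [Fintype J] [Fintype U] [AddCommGroup V] [Module F V]
  [DecidableEq V]

/-- If signed blocks of the vectors `w` sum to the vectors `u`, then a few copies of `w` generate
a set almost as large as the one generated by `u`. -/
lemma card_dilateSum_pow_le {A : Finset F} (hA : A.Nonempty) {w : J → V} {u : U → V} {blk : J → U}
    {sgn : J → F} (hsgn : ∀ j, sgn j = 1 ∨ sgn j = -1)
    (hu : ∀ β : U → F, ∑ v, β v • u v = ∑ j, β (blk j) • (sgn j • w j)) (K : ℕ) :
    (dilateSum A u).card ^ 2 ^ K ≤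
      (dilateSum A fun x : J × Fin K => w x.1).card ^ 2 ^ K * (dilateSum A u).card := by
  classical
  set P : Finset J := univ.filter fun j => sgn j = 1 with hP
  have hne : (Fintype.piFinset fun _ : J => A).Nonempty := Fintype.piFinset_nonempty.2 fun _ => hA
  set X := (Fintype.piFinset fun _ : J => A).image fun β => ∑ j ∈ P, β j • w j with hX
  set Y := (Fintype.piFinset fun _ : J => A).image fun β => ∑ j ∈ Pᶜ, β j • w j with hY
  have hXne : X.Nonempty := hne.image _
  have hYne : Y.Nonempty := hne.image _
  have hsub : dilateSum A u ⊆ X - Y := by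
    intro x hx
    obtain ⟨β, hβ, rfl⟩ := mem_dilateSum.1 hx
    rw [hu, ← sum_add_sum_compl P]
    have hmem : (fun j => β (blk j)) ∈ Fintype.piFinset fun _ : J => A :=
      Fintype.mem_piFinset.2 fun j => hβ _
    have h1 : ∑ j ∈ P, β (blk j) • (sgn j • w j) = ∑ j ∈ P, β (blk j) • w j :=
      sum_congr rfl fun j hj => by rw [(mem_filter.1 hj).2, one_smul]
    have h2 : ∑ j ∈ Pᶜ, β (blk j) • (sgn j • w j) = -∑ j ∈ Pᶜ, β (blk j) • w j := by
      rw [← sum_neg_distrib]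
      refine sum_congr rfl fun j hj => ?_
      have hj' : sgn j ≠ 1 := by simpa [hP] using hj
      rw [(hsgn j).resolve_left hj', neg_one_smul, smul_neg]
    rw [h1, h2, ← sub_eq_add_neg]
    exact sub_mem_sub (mem_image_of_mem _ hmem) (mem_image_of_mem _ hmem)
  have hstep : ∀ k, (dilateSum A fun x : J × Fin k => w x.1) + X + Y ⊆
      dilateSum A fun x : J × Fin (k + 1) => w x.1 := by
    intro k x hx
    obtain ⟨_, hz, _, hy, rfl⟩ := mem_add.1 hx
    obtain ⟨_, he, _, hx', rfl⟩ := mem_add.1 hz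
    obtain ⟨β, hβ, rfl⟩ := mem_dilateSum.1 he
    obtain ⟨β₁, hβ₁, rfl⟩ := mem_image.1 hx'
    obtain ⟨β₂, hβ₂, rfl⟩ := mem_image.1 hy
    rw [Fintype.mem_piFinset] at hβ₁ hβ₂
    refine mem_dilateSum.2 ⟨fun x => Fin.lastCases (motive := fun _ => F)
      (if x.1 ∈ P then β₁ x.1 else β₂ x.1) (fun i => β (x.1, i)) x.2, ?_, ?_⟩
    · rintro ⟨j, i⟩
      induction i using Fin.lastCases with
      | last =>
        simp only [Fin.lastCases_last]
        split_ifs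
        exacts [hβ₁ j, hβ₂ j]
      | cast i => simpa using hβ (j, i)
    · rw [Fintype.sum_prod_type, Fintype.sum_prod_type]
      simp only [Fin.sum_univ_castSucc, Fin.lastCases_last, Fin.lastCases_castSucc]
      rw [sum_add_distrib, add_assoc, ← sum_add_sum_compl P fun x =>
        (if x ∈ P then β₁ x else β₂ x) • w x]
      congr 2
      · exact sum_congr rfl fun j hj => by rw [if_pos hj]
      · exact sum_congr rfl fun j hj => by rw [if_neg (mem_compl.1 hj)]
  have hgrow : ∀ k, (dilateSum A u).card * (dilateSum A fun x : J × Fin k => w x.1).card ≤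
      (dilateSum A fun x : J × Fin (k + 1) => w x.1).card ^ 2 := by
    intro k
    refine (Nat.mul_le_mul_right _ (card_le_card hsub)).trans ?_
    exact (card_sub_mul_card_le hXne hYne _).trans (Nat.pow_le_pow_left (card_le_card (hstep k)) 2)
  induction K with
  | zero =>
    have := (dilateSum_nonempty hA fun x : J × Fin 0 => w x.1).card_pos
    simpa using Nat.le_mul_of_pos_left _ this
  | succ k ih =>
    set E := dilateSum A fun x : J × Fin k => w x.1
    set E' := dilateSum A fun x : J × Fin (k + 1) => w x.1
    set M := (dilateSum A u).card
    calc M ^ 2 ^ (k + 1) = M ^ 2 ^ k * M ^ 2 ^ k := by rw [pow_succ, mul_two, pow_add]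
      _ ≤ M ^ 2 ^ k * (E.card ^ 2 ^ k * M) := Nat.mul_le_mul_left _ ih
      _ = (M * E.card) ^ 2 ^ k * M := by rw [mul_pow]; ring
      _ ≤ (E'.card ^ 2) ^ 2 ^ k * M := Nat.mul_le_mul_right _ (Nat.pow_le_pow_left (hgrow k) _)
      _ = E'.card ^ 2 ^ (k + 1) * M := by rw [← pow_mul, pow_succ, mul_comm 2]

end Ruzsa

section Configuration

open Finset

variable {F ι L : Type*} [Field F] [Fintype ι] [DecidableEq ι] [DecidableEq L] [Fintype L]

/-- Expansion along one additional column `β`. -/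
lemma phi_option (b : ι → L → F) (β : ι → F) :
    phi (fun i l => Option.elim l (β i) (b i)) univ univ = ∑ i, β i * phi b univ (univ.erase i) := by
  have h1 : (univ : Finset (Option L)) = insert none (univ.map Function.Embedding.some) := by
    ext x; cases x <;> simp
  have h0 := phi_insert_col (fun i l => Option.elim l (β i) (b i))
    (k := none) (Q := univ.map Function.Embedding.some) (by simp) univ
  rw [← h1] at h0
  rw [h0]
  refine sum_congr rfl fun i _ => ?_
  have h2 := phi_map (fun i l => Option.elim l (β i) (b i)) (Function.Embedding.refl ι)
    Function.Embedding.some (univ : Finset L) (univ.erase i)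
  rw [map_refl] at h2
  rw [h2]
  rfl

lemma phi_erase_eq_psi (b : ι → L → F) (Q : Finset L) (j : ι) :
    phi b Q (univ.erase j) = psi (fun Q => phi b Q univ) (b j) Q :=
  eq_psi (c := fun Q => phi b Q (univ.erase j)) (fun Q => phi_erase_row b Q (mem_univ j)) Q

/-- `phi` depends affinely on a single entry. -/
lemma phi_affine {b : F → ι → L → F} {i₀ : ι} {k : L}
    (hb : ∀ t, ∀ i ≠ i₀, b t i = b 0 i) (hb₀ : ∀ t l, b t i₀ l = b 0 i₀ l + if l = k then t else 0)
    (Q : Finset L) (t : F) :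
    phi (b t) Q univ = phi (b 0) Q univ + t * (phi (b 1) Q univ - phi (b 0) Q univ) := by
  have hrest : ∀ t Q', phi (b t) Q' (univ.erase i₀) = phi (b 0) Q' (univ.erase i₀) := fun t Q' =>
    phi_congr fun i hi l _ => by rw [hb t i (ne_of_mem_erase hi)]
  have h : ∀ t, phi (b t) Q univ = phi (b 0) Q univ +
      t * ∑ l ∈ Q, if l = k then phi (b 0) (Q.erase l) (univ.erase i₀) else 0 := by
    intro t
    have hi : ∀ t, phi (b t) Q univ = phi (b t) Q (univ.erase i₀) +
        ∑ l ∈ Q, b t i₀ l * phi (b t) (Q.erase l) (univ.erase i₀) := fun t => by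
      conv_lhs => rw [← insert_erase (mem_univ i₀), phi_insert _ _ (notMem_erase _ _)]
    rw [hi t, hi 0, hrest, mul_sum, add_assoc, ← sum_add_distrib]
    congr 1
    refine sum_congr rfl fun l _ => ?_
    rw [hb₀, hrest]
    split_ifs <;> ring
  rw [h t, h 1]
  ring

lemma univ_erase_zero_eq_map_succ (q : ℕ) :
    (univ.erase (0 : Fin (q + 1))) = univ.map (Fin.succEmb q) := by
  ext x
  cases x using Fin.cases <;> simp [Fin.succ_ne_zero]

/-- One free column of a matrix realises all linear combinations of the complementary
permanents. -/
lemma card_image_dilateSum_le_ncard_permSet [DecidableEq F] [Finite F] {A : Finset F} (h1 : 1 ∈ A)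
    {X R : Type*} [Fintype X] [DecidableEq X] [Fintype R] [DecidableEq R] {b : X ⊕ R → L → F}
    (hb : ∀ i l, b i l ∈ A) {n : ℕ} (hn : Fintype.card X + Fintype.card R = n)
    (hL : Fintype.card L + 1 ≤ n) (hfact : (n.factorial : F) ≠ 0) {w : X → F × F} {t : F}
    (hw : ∀ x, phi b univ (univ.erase (Sum.inl x)) = (w x).1 + t * (w x).2) :
    ((dilateSum A w).image fun e => e.1 + t * e.2).card ≤ (permSet n A).ncard := by
  set e := ∑ i, phi b univ (univ.erase (Sum.inr i)) with he
  have hfact' : ((n - Fintype.card (Option L)).factorial : F) ≠ 0 := by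
    obtain ⟨c, hc⟩ := Nat.factorial_dvd_factorial (Nat.sub_le n (Fintype.card (Option L)))
    rw [hc, Nat.cast_mul] at hfact
    exact left_ne_zero_of_mul hfact
  have hsub : (fun x => ((n - Fintype.card (Option L)).factorial : F) * (x + e)) ''
      ((dilateSum A w).image fun e => e.1 + t * e.2 : Finset F) ⊆ permSet n A := by
    rintro _ ⟨x, hx, rfl⟩
    rw [mem_coe, mem_image] at hx
    obtain ⟨v, hv, rfl⟩ := hx
    obtain ⟨β, hβ, rfl⟩ := mem_dilateSum.1 hv
    have hB : ∀ i (l : Option L), (fun i l =>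
        Option.elim l (Sum.elim β (fun _ => 1) i) (b i) : X ⊕ R → Option L → F) i l ∈ A := by
      rintro (i | i) (_ | l)
      exacts [hβ i, hb _ _, h1, hb _ _]
    have hmem := factorial_mul_phi_mem_permSet h1 (by simpa using hn) (by simpa using hL) hB
    rw [phi_option, Fintype.sum_sum_type] at hmem
    convert hmem using 2
    simp only [Sum.elim_inl, Sum.elim_inr, hw, one_mul, he, Prod.fst_sum, Prod.snd_sum,
      Prod.smul_fst, Prod.smul_snd, smul_eq_mul, mul_add, mul_sum, sum_add_distrib,
      mul_left_comm t]
  have hinj : Function.Injective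
      fun x => ((n - Fintype.card (Option L)).factorial : F) * (x + e) := fun x y hxy =>
    add_right_cancel (mul_left_cancel₀ hfact' hxy)
  have h := Set.ncard_le_ncard hsub (Set.toFinite _)
  rwa [Set.ncard_image_of_injective _ hinj, Set.ncard_coe_finset] at h

/-- The permanents of a suitable family of matrices, as one free entry `t` and a free column
vary, contain all projections in directions `t` of a planar set of linear combinations. -/
lemma exists_psi_configuration {A : Finset F} (h1 : 1 ∈ A) (k : L) {J : Type*} [Fintype J]
    {row : J → L → F} (hrow : ∀ j l, row j l ∈ A) {n K : ℕ} (hn : Fintype.card J * K + 1 ≤ n)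
    (hL : Fintype.card L + 1 ≤ n) (hfact : (n.factorial : F) ≠ 0) [DecidableEq F] [Finite F] :
    ∃ T G : Finset L → F, T ∅ = 1 ∧ G ∅ = 0 ∧ G {k} = 1 ∧
      ∀ t ∈ A, ((dilateSum A fun x : J × Fin K =>
        (psi T (row x.1) univ, psi G (row x.1) univ)).image fun e => e.1 + t * e.2).card ≤
          (permSet n A).ncard := by
  classical
  set r := n - (Fintype.card J * K + 1) with hr
  let b : F → (J × Fin K) ⊕ (Unit ⊕ Fin r) → L → F := fun t =>
    Sum.elim (fun x => row x.1) (Sum.elim (fun _ l => if l = k then t else 1) fun _ _ => 1)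
  have hb : ∀ t, ∀ i ≠ Sum.inr (Sum.inl ()), b t i = b 0 i := by
    rintro t (i | i | i) hi
    exacts [rfl, absurd rfl hi, rfl]
  have hTG : ∀ t, (fun Q => phi (b t) Q univ) = fun Q =>
      phi (b 0) Q univ + t * (phi (b 1) Q univ - phi (b 0) Q univ) := fun t =>
    funext fun Q => phi_affine (k := k) hb
      (fun t l => by by_cases hl : l = k <;> simp [b, hl]) Q t
  refine ⟨fun Q => phi (b 0) Q univ, fun Q => phi (b 1) Q univ - phi (b 0) Q univ,
    phi_no_cols _ _, by simp [phi_no_cols], ?_, fun t ht =>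
      card_image_dilateSum_le_ncard_permSet h1 (b := b t) ?_ ?_ hL hfact fun x => ?_⟩
  · simp only [phi_singleton, Fintype.sum_sum_type]
    simp [b]
  · rintro (i | i | i) l
    · exact hrow _ _
    · simp only [b, Sum.elim_inr, Sum.elim_inl]
      split_ifs
      exacts [ht, h1]
    · exact h1
  · simp only [Fintype.card_sum, Fintype.card_unit, Fintype.card_prod, Fintype.card_fin]
    omega
  · rw [phi_erase_eq_psi, hTG, psi_add_mul]
    rfl

/-- The permanents of a suitable family of matrices, as the free entry `t` and the free column
vary, contain all projections in directions `t` of a planar set of linear combinations of vectors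
`w j`, which signed blocks combine to multiples of prescribed products of differences. -/
theorem exists_configuration {p : ℕ} [Fact p.Prime] {A : Finset (ZMod p)} (h1 : 1 ∈ A)
    {n q K : ℕ} {V₁ V₂ : Type} [Fintype V₁] [Fintype V₂] {d₁ : V₁ → ZMod p} {d₂ : V₂ → ZMod p}
    (hd₁ : ∀ v, IsDiffProd A (q + 1) (d₁ v)) (hd₂ : ∀ v, IsDiffProd A q (d₂ v))
    (hn : (Fintype.card V₁ * 2 ^ (q + 1) + Fintype.card V₂ * 2 ^ q) * K + 1 ≤ n)
    (hq : q + 2 ≤ n) (hnp : n < p) :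
    ∃ (J : Type) (_ : Fintype J) (w : J → ZMod p × ZMod p) (blk : J → V₁ ⊕ V₂) (sgn : J → ZMod p)
      (κ₁ κ₂ s : ZMod p), κ₁ ≠ 0 ∧ κ₂ ≠ 0 ∧ (∀ j, sgn j = 1 ∨ sgn j = -1) ∧
      (∀ β : V₁ ⊕ V₂ → ZMod p, ∑ v, β v • (Sum.elim (fun v => (κ₁ * d₁ v, 0))
        (fun v => (κ₂ * s * d₂ v, κ₂ * d₂ v)) v : ZMod p × ZMod p) =
          ∑ j, β (blk j) • (sgn j • w j)) ∧
      ∀ t ∈ A, ((dilateSum A fun x : J × Fin K => w x.1).image fun e => e.1 + t * e.2).card ≤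
        (permSet n A).ncard := by
  classical
  have hp : p.Prime := Fact.out
  have hfact : ∀ k, k ≤ n → (k.factorial : ZMod p) ≠ 0 := fun k hk => by
    rw [Ne, ZMod.natCast_eq_zero_iff, hp.dvd_factorial]
    omega
  choose y₁ y₁' hy₁ hy₁' hd₁ using hd₁
  choose y₂ y₂' hy₂ hy₂' hd₂ using hd₂
  obtain ⟨row, hrow⟩ : ∃ row : (V₁ × ↥(univ : Finset (Fin (q + 1))).powerset) ⊕
      (V₂ × ↥(univ.erase (0 : Fin (q + 1))).powerset) → Fin (q + 1) → ZMod p,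
      row = Sum.elim (fun x => mixRow (y₁ x.1) (y₁' x.1) x.2)
        fun x => mixRow (Fin.cons 1 (y₂ x.1)) (Fin.cons 1 (y₂' x.1)) x.2 := ⟨_, rfl⟩
  have hrowA : ∀ j l, row j l ∈ A := by
    rw [hrow]
    rintro (⟨v, S⟩ | ⟨v, S⟩) l
    · simp only [Sum.elim_inl, mixRow]
      split_ifs
      exacts [hy₁' v l, hy₁ v l]
    · simp only [Sum.elim_inr, mixRow]
      split_ifs <;> cases l using Fin.cases <;> simp [h1, hy₂, hy₂']
  obtain ⟨T, G, hT, hG, hG0, hTG⟩ := exists_psi_configuration h1 (0 : Fin (q + 1)) hrowA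
    (n := n) (K := K) (by
      rw [Fintype.card_sum, Fintype.card_prod, Fintype.card_prod, Fintype.card_coe,
        Fintype.card_coe, card_powerset, card_powerset, card_erase_of_mem (mem_univ _)]
      simpa using hn) (by rw [Fintype.card_fin]; omega) (hfact n le_rfl)
  have hsgn : ∀ k : ℕ, (-1 : ZMod p) ^ k ≠ 0 := fun k => pow_ne_zero _ (neg_ne_zero.2 one_ne_zero)
  refine ⟨_, inferInstance, fun j => (psi T (row j) univ, psi G (row j) univ),
    Sum.map Prod.fst Prod.fst,
    Sum.elim (fun x => (-1) ^ x.2.1.card) (fun x => (-1) ^ x.2.1.card),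
    (-1) ^ (q + 1) * ((q + 1).factorial : ZMod p), (-1) ^ q * (q.factorial : ZMod p),
    T {0} - (q + 1), mul_ne_zero (hsgn _) (hfact _ (by omega)),
    mul_ne_zero (hsgn _) (hfact _ (by omega)), ?_, fun β => ?_, hTG⟩
  · rintro (j | j) <;> exact neg_one_pow_eq_or _ _
  rw [Fintype.sum_sum_type, Fintype.sum_sum_type, Fintype.sum_prod_type, Fintype.sum_prod_type]
  have hcons : ∀ v, ∏ l ∈ univ.erase (0 : Fin (q + 1)),
      ((Fin.cons 1 (y₂ v) : Fin (q + 1) → ZMod p) l -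
        (Fin.cons 1 (y₂' v) : Fin (q + 1) → ZMod p) l) = d₂ v := by
    intro v
    rw [univ_erase_zero_eq_map_succ, prod_map, hd₂]
    simp
  congr 1
  · refine sum_congr rfl fun v _ => ?_
    simp only [Sum.map_inl, Sum.elim_inl]
    rw [← smul_sum]
    congr 1
    have h := fun H => sum_powerset_psi_mixRow H (y₁ v) (y₁' v) univ
    simp only [card_univ, Fintype.card_fin, ← hd₁] at h
    ext
    · rw [Prod.fst_sum]
      simp only [Prod.smul_fst, smul_eq_mul, hrow, Sum.elim_inl]
      rw [sum_coe_sort _ fun S => (-1) ^ S.card * psi T (mixRow (y₁ v) (y₁' v) S) univ, h, hT,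
        mul_one]
    · rw [Prod.snd_sum]
      simp only [Prod.smul_snd, smul_eq_mul, hrow, Sum.elim_inl]
      rw [sum_coe_sort _ fun S => (-1) ^ S.card * psi G (mixRow (y₁ v) (y₁' v) S) univ, h, hG]
      ring
  · refine sum_congr rfl fun v _ => ?_
    simp only [Sum.map_inr, Sum.elim_inr]
    rw [← smul_sum]
    congr 1
    have h := fun H => sum_powerset_psi_mixRow_insert H (Fin.cons 1 (y₂ v))
      (Fin.cons 1 (y₂' v)) (notMem_erase (0 : Fin (q + 1)) univ)
    simp only [insert_erase (mem_univ _), hcons, card_erase_of_mem (mem_univ _), card_univ,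
      Fintype.card_fin, add_tsub_cancel_right, Fin.cons_zero, mul_one] at h
    ext
    · rw [Prod.fst_sum]
      simp only [Prod.smul_fst, smul_eq_mul, hrow, Sum.elim_inr]
      rw [sum_coe_sort _ fun S => (-1) ^ S.card *
        psi T (mixRow (Fin.cons 1 (y₂ v)) (Fin.cons 1 (y₂' v)) S) univ, h, hT, mul_one]
    · rw [Prod.snd_sum]
      simp only [Prod.smul_snd, smul_eq_mul, hrow, Sum.elim_inr]
      rw [sum_coe_sort _ fun S => (-1) ^ S.card *
        psi G (mixRow (Fin.cons 1 (y₂ v)) (Fin.cons 1 (y₂' v)) S) univ, h, hG, hG0]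
      ring

end Configuration

section LowerBound

open Finset

lemma image_dilateSum {F ι V W : Type*} [Field F] [Fintype ι] [AddCommGroup V] [Module F V]
    [AddCommGroup W] [Module F W] [DecidableEq W] (A : Finset F) (c : ι → V) (f : V →ₗ[F] W) :
    (dilateSum A c).image f = dilateSum A (f ∘ c) := by
  ext x
  simp only [mem_image, mem_dilateSum]
  constructor
  · rintro ⟨_, ⟨β, hβ, rfl⟩, rfl⟩
    exact ⟨β, hβ, by simp⟩
  · rintro ⟨β, hβ, rfl⟩
    exact ⟨_, ⟨β, hβ, rfl⟩, by simp⟩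

variable {p : ℕ} [Fact p.Prime] {A : Finset (ZMod p)}

/-- The permanents of `n × n` matrices over `A` are at least about `min (|A| ^ m) p ^ (1 / 2)`
many, where `2 ^ (2 * m - 1) ≤ n`. -/
theorem one_div_ncard_permSet_sq_le (h1 : 1 ∈ A) (hA : 2 ≤ A.card) {n q : ℕ}
    (hn : 2 ^ (2 * q + 3) ≤ n) (hnp : n < p) :
    (1 : ℝ) / ((permSet n A).ncard : ℝ) ^ 2 ≤ 1 / (A.card : ℝ) ^ (q + 2) + 2 / p := by
  have hAne : A.Nonempty := ⟨1, h1⟩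
  obtain ⟨V, _, d, hcard, hd, hX⟩ := exists_large_dilateSum hA (q + 1)
  have hV : Fintype.card V * 2 ^ (q + 1) + 1 ≤ n := by
    refine le_trans ?_ hn
    have h2 : 2 ^ (2 * q + 3) = (Fintype.card V + 1) * 2 ^ (q + 1) := by
      rw [hcard]; ring
    have := Nat.one_le_two_pow (n := q + 1)
    rw [h2, add_mul]
    omega
  obtain ⟨J, _, w, blk, sgn, κ₁, κ₂, s, hκ₁, -, hsgn, hu, himage⟩ := exists_configuration h1
    (K := 1) (V₂ := Empty) (d₂ := Empty.elim) hd (fun v => v.elim) (by simpa using hV)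
    (by have := Nat.lt_two_pow_self (n := 2 * q + 3); omega) hnp
  set f : ZMod p × ZMod p →ₗ[ZMod p] ZMod p := LinearMap.fst _ _ _ + LinearMap.snd _ _ _ with hf
  set u : V ⊕ Empty → ZMod p × ZMod p := Sum.elim (fun v => (κ₁ * d v, 0))
    (fun v => (κ₂ * s * v.elim, κ₂ * v.elim)) with hudef
  have hpow := card_dilateSum_pow_le hAne (u := f ∘ u) (w := f ∘ w) hsgn (fun β => by
    have := congrArg f (hu β)
    simpa only [map_sum, map_smul, Function.comp_apply] using this) 1
  have hE : (dilateSum A fun x : J × Fin 1 => (f ∘ w) x.1).card ≤ (permSet n A).ncard := by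
    refine le_trans (le_of_eq ?_) (himage 1 h1)
    rw [show (fun x : J × Fin 1 => (f ∘ w) x.1) = f ∘ fun x : J × Fin 1 => w x.1 from rfl,
      ← image_dilateSum]
    simp only [hf, one_mul]
    rfl
  have hXle : (dilateSum A d).card ≤ (dilateSum A (f ∘ u)).card := by
    rw [← card_image_of_injective _ (mul_right_injective₀ hκ₁)]
    refine card_le_card fun x hx => ?_
    obtain ⟨y, hy, rfl⟩ := mem_image.1 hx
    obtain ⟨β, hβ, rfl⟩ := mem_dilateSum.1 hy
    refine mem_dilateSum.2 ⟨Sum.elim β Empty.elim, ?_, ?_⟩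
    · rintro (v | v)
      exacts [hβ v, v.elim]
    · simp [hudef, hf, mul_sum, mul_left_comm]
  have hX0 := (dilateSum_nonempty hAne d).card_pos
  have hle : (dilateSum A d).card ≤ (permSet n A).ncard ^ 2 := by
    rw [pow_one, sq (dilateSum A (f ∘ u)).card] at hpow
    exact hXle.trans ((Nat.le_of_mul_le_mul_right hpow (hX0.trans_le hXle)).trans
      (Nat.pow_le_pow_left hE 2))
  refine le_trans (one_div_le_one_div_of_le (by exact_mod_cast hX0) ?_) hX
  exact_mod_cast hle

/-- Every combination of the two blocks of `exists_configuration` is determined by its two parts. -/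
lemma card_dilateSum_sum_elim {V₁ V₂ : Type*} [Fintype V₁] [Fintype V₂] {d₁ : V₁ → ZMod p}
    {d₂ : V₂ → ZMod p} {κ₁ κ₂ s : ZMod p} (hκ₁ : κ₁ ≠ 0) (hκ₂ : κ₂ ≠ 0) :
    (dilateSum A (Sum.elim (fun v => (κ₁ * d₁ v, 0)) (fun v => (κ₂ * s * d₂ v, κ₂ * d₂ v)) :
      V₁ ⊕ V₂ → ZMod p × ZMod p)).card = (dilateSum A d₁).card * (dilateSum A d₂).card := by
  classical
  have hinj : Function.Injective fun x : ZMod p × ZMod p =>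
      (κ₁ * x.1 + κ₂ * s * x.2, κ₂ * x.2) := by
    rintro ⟨x, y⟩ ⟨x', y'⟩ h
    simp only [Prod.mk.injEq, mul_right_inj' hκ₂] at h
    obtain ⟨h, rfl⟩ := h
    simpa [hκ₁] using h
  rw [← card_product, ← card_image_of_injective (dilateSum A d₁ ×ˢ dilateSum A d₂) hinj]
  congr 1
  ext x
  simp only [mem_image, mem_product, mem_dilateSum]
  have hsum : ∀ (β₁ : V₁ → ZMod p) (β₂ : V₂ → ZMod p),
      ∑ v, β₁ v • ((κ₁ * d₁ v, 0) : ZMod p × ZMod p) +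
        ∑ v, β₂ v • ((κ₂ * s * d₂ v, κ₂ * d₂ v) : ZMod p × ZMod p) =
      (κ₁ * ∑ v, β₁ v • d₁ v + κ₂ * s * ∑ v, β₂ v • d₂ v, κ₂ * ∑ v, β₂ v • d₂ v) := by
    intro β₁ β₂
    ext <;> simp [Prod.fst_sum, Prod.snd_sum, mul_sum, mul_left_comm]
  constructor
  · rintro ⟨β, hβ, rfl⟩
    refine ⟨(∑ v, β (Sum.inl v) • d₁ v, ∑ v, β (Sum.inr v) • d₂ v),
      ⟨⟨_, fun v => hβ _, rfl⟩, ⟨_, fun v => hβ _, rfl⟩⟩, ?_⟩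
    rw [Fintype.sum_sum_type]
    exact (hsum _ _).symm
  · rintro ⟨⟨_, _⟩, ⟨⟨β₁, h₁, rfl⟩, ⟨β₂, h₂, rfl⟩⟩, rfl⟩
    refine ⟨Sum.elim β₁ β₂, Sum.rec h₁ h₂, ?_⟩
    rw [Fintype.sum_sum_type]
    exact hsum _ _

lemma ten_mul_le_of_lt {n q : ℕ} (hn : 1024 ≤ n) (hq : 2 ^ (5 * q) ≤ n) :
    10 * 2 ^ (2 * q) * (q + 2) ≤ n := by
  rcases lt_or_ge q 3 with h | h
  · interval_cases q <;> omega
  · refine le_trans ?_ hq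
    have h8 : 10 * (q + 2) ≤ 2 ^ (3 * q) := by
      induction q, h using Nat.le_induction with
      | base => norm_num
      | succ q h ih =>
        have := ih ((Nat.pow_le_pow_right two_pos (by omega)).trans hq)
        rw [show 3 * (q + 1) = 3 * q + 3 by ring, pow_add]
        omega
    calc 10 * 2 ^ (2 * q) * (q + 2) = 2 ^ (2 * q) * (10 * (q + 2)) := by ring
      _ ≤ 2 ^ (2 * q) * 2 ^ (3 * q) := by gcongr
      _ = 2 ^ (5 * q) := by rw [← pow_add]; congr 1; ring

/-- A set whose `2 ^ K`-th power bounds that of a quarter of the plane is large. -/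
lemma sq_le_seven_mul_of_pow_le {a e M P : ℝ} {q : ℕ} (ha : 2 ≤ a) (he : 0 < e) (hP : 0 < P)
    (hPa : P ≤ a ^ (q + 1)) (hM : P ^ 2 / 9 ≤ M) (hM' : M ≤ P ^ 2)
    (h : M ^ 2 ^ (q + 2) ≤ e ^ 2 ^ (q + 2) * M) : P ^ 2 ≤ 7 * (e * a) := by
  by_contra! hlt
  have hMe : 7 / 9 * a < M / e := by
    rw [lt_div_iff₀ he]
    linarith
  have ha2 : a ≤ (7 / 9 * a) ^ 2 := by nlinarith
  have hexp : 2 * (q + 1) ≤ 2 ^ (q + 1) := by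
    rw [pow_succ]
    have := Nat.lt_two_pow_self (n := q)
    omega
  have h1 : (7 / 9 * a) ^ 2 ^ (q + 2) < (M / e) ^ 2 ^ (q + 2) :=
    pow_lt_pow_left₀ hMe (by positivity) (by positivity)
  have h2 : (M / e) ^ 2 ^ (q + 2) ≤ M := by
    rw [div_pow, div_le_iff₀ (by positivity), mul_comm]
    exact h
  have h3 : P ^ 2 ≤ (7 / 9 * a) ^ 2 ^ (q + 2) := by
    calc P ^ 2 ≤ (a ^ (q + 1)) ^ 2 := by gcongr
      _ = a ^ (2 * (q + 1)) := by rw [← pow_mul, mul_comm]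
      _ ≤ a ^ 2 ^ (q + 1) := pow_le_pow_right₀ (by linarith) hexp
      _ ≤ ((7 / 9 * a) ^ 2) ^ 2 ^ (q + 1) := by gcongr
      _ = (7 / 9 * a) ^ 2 ^ (q + 2) := by rw [← pow_mul, pow_succ' 2 (q + 1)]
  linarith

/-- The permanents of `n × n` matrices over `A` fill an eighth of the field once `n` is large. -/
theorem le_eight_mul_ncard_permSet (h1 : 1 ∈ A) (hA : 2 ≤ A.card) {n q : ℕ} (hn : 1024 ≤ n)
    (hq : 2 ^ (5 * q) ≤ n) (hnp : n < p) (hAp : p ≤ A.card ^ (q + 1)) :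
    (p : ℝ) ≤ 8 * (permSet n A).ncard := by
  classical
  have hAne : A.Nonempty := ⟨1, h1⟩
  have hp : (0 : ℝ) < p := by exact_mod_cast (Fact.out : p.Prime).pos
  have hA2 : (2 : ℝ) ≤ A.card := by exact_mod_cast hA
  have hAp' : (p : ℝ) ≤ (A.card : ℝ) ^ (q + 1) := by exact_mod_cast hAp
  have hlarge : ∀ {V : Type} [Fintype V] {d : V → ZMod p} {m : ℕ}, q ≤ m →
      (1 : ℝ) / (dilateSum A d).card ≤ 1 / (A.card : ℝ) ^ (m + 1) + 2 / p →
      (p : ℝ) / 3 ≤ (dilateSum A d).card := by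
    intro V _ d m hm h
    have hd : (0 : ℝ) < (dilateSum A d).card := by
      exact_mod_cast (dilateSum_nonempty hAne d).card_pos
    have h2 : (1 : ℝ) / (A.card : ℝ) ^ (m + 1) ≤ 1 / p :=
      one_div_le_one_div_of_le hp (hAp'.trans (pow_le_pow_right₀ (by linarith) (by omega)))
    have h3 : (1 : ℝ) / (dilateSum A d).card ≤ 3 / p := by
      calc _ ≤ _ := h
        _ ≤ 1 / p + 2 / p := by gcongr
        _ = 3 / p := by ring
    rw [div_le_div_iff₀ hd hp] at h3
    linarith
  obtain ⟨V₁, _, d₁, hcard₁, hd₁, hX₁⟩ := exists_large_dilateSum hA (q + 1)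
  obtain ⟨V₂, _, d₂, hcard₂, hd₂, hX₂⟩ := exists_large_dilateSum hA q
  have hrows : (Fintype.card V₁ * 2 ^ (q + 1) + Fintype.card V₂ * 2 ^ q) * (q + 2) + 1 ≤ n := by
    refine le_trans ?_ (ten_mul_le_of_lt hn hq)
    have h2 : 10 * 2 ^ (2 * q) =
        (Fintype.card V₁ + 1) * 2 ^ (q + 1) + (Fintype.card V₂ + 1) * 2 ^ q := by
      rw [hcard₁, hcard₂]; ring
    rw [h2]
    have := Nat.one_le_two_pow (n := q)
    nlinarith [Nat.one_le_two_pow (n := q + 1)]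
  obtain ⟨J, _, w, blk, sgn, κ₁, κ₂, s, hκ₁, hκ₂, hsgn, hu, himage⟩ :=
    exists_configuration h1 hd₁ hd₂ hrows (le_trans (Nat.le_mul_of_pos_left _
      (by positivity)) (ten_mul_le_of_lt hn hq)) hnp
  have hpow := card_dilateSum_pow_le hAne hsgn hu (q + 2)
  rw [card_dilateSum_sum_elim hκ₁ hκ₂] at hpow
  set E := dilateSum A fun x : J × Fin (q + 2) => w x.1 with hE
  have hEne : E.Nonempty := dilateSum_nonempty hAne _
  have hE0 : (0 : ℝ) < E.card := by exact_mod_cast hEne.card_pos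
  have hle : ∀ {V : Type} [Fintype V] (d : V → ZMod p), ((dilateSum A d).card : ℝ) ≤ p :=
    fun d => by exact_mod_cast (card_le_univ (dilateSum A d)).trans_eq (ZMod.card p)
  have hEA := sq_le_seven_mul_of_pow_le (M := (dilateSum A d₁).card * (dilateSum A d₂).card)
    hA2 hE0 hp hAp' (by nlinarith [hlarge (by omega) hX₁, hlarge le_rfl hX₂])
    (by rw [sq]; exact mul_le_mul (hle d₁) (hle d₂) (by positivity) hp.le)
    (by exact_mod_cast hpow)
  obtain ⟨t, ht, h⟩ := exists_large_projection hEne hAne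
  have hI : (0 : ℝ) < (E.image fun e => e.1 + t * e.2).card := by
    exact_mod_cast (hEne.image _).card_pos
  have hI' : ((E.image fun e => e.1 + t * e.2).card : ℝ) ≤ (permSet n A).ncard := by
    exact_mod_cast himage t ht
  have h7 : (p : ℝ) / (E.card * A.card) ≤ 7 / p := by
    rw [div_le_div_iff₀ (by positivity) hp]
    linarith
  have h8 : (1 : ℝ) / (E.image fun e => e.1 + t * e.2).card ≤ 8 / p := by
    calc _ ≤ _ := h
      _ ≤ 1 / p + 7 / p := by gcongr
      _ = 8 / p := by ring
  rw [div_le_div_iff₀ hI hp] at h8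
  linarith

lemma min_rpow_le_of_one_mem (h1 : 1 ∈ A) (hA : 2 ≤ A.card) {n : ℕ} (hn : 1 ≤ n) :
    (1 / 8 : ℝ) * min ((A.card : ℝ) ^ (Real.logb 2 n / 10)) (p : ℝ) ≤
      ((permSet n A).ncard : ℝ) := by
  set L := Real.logb 2 n with hL
  have hn1 : (1 : ℝ) ≤ n := by exact_mod_cast hn
  have hn0 : (0 : ℝ) < n := by linarith
  have hL0 : 0 ≤ L := Real.logb_nonneg one_lt_two hn1
  have hnL : (n : ℝ) = 2 ^ L := (Real.rpow_logb two_pos (by norm_num) hn0).symm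
  have hA2 : (2 : ℝ) ≤ A.card := by exact_mod_cast hA
  have hA0 : (0 : ℝ) < A.card := by linarith
  have hp : (0 : ℝ) < p := by exact_mod_cast (Fact.out : p.Prime).pos
  have hmin : 0 ≤ min ((A.card : ℝ) ^ (L / 10)) (p : ℝ) :=
    le_min (Real.rpow_nonneg hA0.le _) hp.le
  have hdir : min (p : ℝ) (n * (A.card - 1) + 1) ≤ (permSet n A).ncard := by
    have h := min_le_ncard_permSet h1 hA hn
    have h' : ((min p (n * (A.card - 1) + 1) : ℕ) : ℝ) ≤ (permSet n A).ncard := by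
      exact_mod_cast h
    rwa [Nat.cast_min, Nat.cast_add, Nat.cast_mul, Nat.cast_sub (by omega), Nat.cast_one] at h'
  have hsmall : (A.card : ℝ) ^ (L / 10) ≤ n * (A.card - 1) + 1 →
      (1 / 8 : ℝ) * min ((A.card : ℝ) ^ (L / 10)) (p : ℝ) ≤ (permSet n A).ncard := by
    intro h
    have : min ((A.card : ℝ) ^ (L / 10)) (p : ℝ) ≤ min (p : ℝ) (n * (A.card - 1) + 1) := by
      rw [min_comm]
      exact min_le_min_left _ h
    linarith
  rcases lt_or_ge n p with hnp | hnp
  swap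
  · have hnp' : (p : ℝ) ≤ n := by exact_mod_cast hnp
    have h : min (p : ℝ) (n * (A.card - 1) + 1) = p := min_eq_left (by nlinarith)
    have := min_le_right ((A.card : ℝ) ^ (L / 10)) (p : ℝ)
    linarith
  rcases lt_or_ge n 1024 with hn' | hn'
  · apply hsmall
    have hL10 : L ≤ 10 := by
      rw [hL, Real.logb_le_iff_le_rpow one_lt_two hn0]
      norm_num
      exact_mod_cast hn'.le
    calc (A.card : ℝ) ^ (L / 10) ≤ (A.card : ℝ) ^ (1 : ℝ) :=
          Real.rpow_le_rpow_of_exponent_le (by linarith) (by linarith)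
      _ = A.card := Real.rpow_one _
      _ ≤ n * (A.card - 1) + 1 := by nlinarith
  rcases le_or_gt ((A.card : ℝ) ^ (L / 5)) p with hAL | hAL
  · obtain ⟨q, hq⟩ : ∃ q, Nat.log 2 n = 2 * q + 3 ∨ Nat.log 2 n = 2 * q + 4 := by
      have : 10 ≤ Nat.log 2 n := (Nat.le_log_iff_pow_le one_lt_two (by omega)).2 (by omega)
      exact ⟨(Nat.log 2 n - 3) / 2, by omega⟩
    have hqn : 2 ^ (2 * q + 3) ≤ n :=
      (Nat.pow_le_pow_right two_pos (by omega)).trans (Nat.pow_log_le_self 2 (by omega))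
    have hLq : L ≤ 2 * q + 5 := by
      have h := (Nat.lt_pow_succ_log_self one_lt_two n).le.trans
        (Nat.pow_le_pow_right two_pos (by omega : Nat.log 2 n + 1 ≤ 2 * q + 5))
      rw [hL, Real.logb_le_iff_le_rpow one_lt_two hn0]
      exact_mod_cast h
    have hpow : (A.card : ℝ) ^ (L / 5) ≤ (A.card : ℝ) ^ (q + 2) := by
      rw [← Real.rpow_natCast]
      refine Real.rpow_le_rpow_of_exponent_le (by linarith) ?_
      push_cast
      linarith [(Nat.cast_nonneg q : (0 : ℝ) ≤ q)]
    have hsq : (A.card : ℝ) ^ (L / 5) = ((A.card : ℝ) ^ (L / 10)) ^ 2 := by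
      rw [← Real.rpow_natCast, ← Real.rpow_mul hA0.le]
      congr 1
      push_cast
      ring
    have hx : 0 < (A.card : ℝ) ^ (L / 10) := Real.rpow_pos_of_pos hA0 _
    rw [hsq] at hpow hAL
    clear hsmall hsq hmin
    generalize (A.card : ℝ) ^ (L / 10) = x at *
    have hN : (0 : ℝ) < (permSet n A).ncard := by
      refine lt_of_lt_of_le (lt_min hp ?_) hdir
      nlinarith
    have h3 : (1 : ℝ) / ((permSet n A).ncard : ℝ) ^ 2 ≤ 3 / x ^ 2 := by
      calc _ ≤ _ := one_div_ncard_permSet_sq_le h1 hA hqn hnp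
        _ ≤ 1 / x ^ 2 + 2 / x ^ 2 := by gcongr
        _ = 3 / x ^ 2 := by ring
    rw [div_le_div_iff₀ (by positivity) (by positivity), one_mul] at h3
    have h4 : x ≤ 2 * (permSet n A).ncard :=
      le_of_sq_le_sq (by nlinarith) (by positivity)
    linarith [min_le_left x (p : ℝ)]
  · set q := Nat.log A.card (p - 1) with hq
    have hp2 := (Fact.out : p.Prime).two_le
    have hpq : A.card ^ q ≤ p - 1 := Nat.pow_log_le_self _ (by omega)
    have hpq' : p - 1 < A.card ^ (q + 1) := Nat.lt_pow_succ_log_self (by omega) _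
    have hlt : (A.card : ℝ) ^ (q : ℝ) < (A.card : ℝ) ^ (L / 5) := by
      refine lt_of_le_of_lt ?_ hAL
      rw [Real.rpow_natCast]
      exact_mod_cast hpq.trans (Nat.sub_le _ _)
    rw [Real.rpow_lt_rpow_left_iff (by linarith)] at hlt
    have hqn : 2 ^ (5 * q) ≤ n := by
      have : (2 : ℝ) ^ ((5 * q : ℕ) : ℝ) ≤ n := by
        rw [hnL]
        refine Real.rpow_le_rpow_of_exponent_le one_le_two ?_
        push_cast
        linarith
      rw [Real.rpow_natCast] at this
      exact_mod_cast this
    have := le_eight_mul_ncard_permSet h1 hA hn' hqn hnp (by omega)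
    linarith [min_le_right ((A.card : ℝ) ^ (L / 10)) (p : ℝ)]

end LowerBound

/-- For `A ⊆ 𝔽_p` with `|A| ≥ 2` and every `n ≥ 1`,
`|P_n(A)| ≥ (1/8) · min(|A|^{(log₂ n)/10}, p)`. -/
theorem card_permSet_ge_rpow_logb {p : ℕ} [Fact p.Prime] (A : Finset (ZMod p))
    (hA : 2 ≤ A.card) :
    ∀ n : ℕ, 1 ≤ n →
      (1 / 8 : ℝ) * min ((A.card : ℝ) ^ (Real.logb 2 n / 10)) (p : ℝ) ≤
        ((permSet n A).ncard : ℝ) := by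
  intro n hn
  obtain ⟨a, ha, ha0⟩ : ∃ a ∈ A, a ≠ 0 := by
    obtain ⟨a, ha, b, hb, hab⟩ := Finset.one_lt_card.1 hA
    rcases eq_or_ne a 0 with rfl | h
    exacts [⟨b, hb, hab.symm⟩, ⟨a, ha, h⟩]
  have hcard := Finset.card_image_of_injective A (mul_right_injective₀ (inv_ne_zero ha0))
  have h := min_rpow_le_of_one_mem (A := A.image (a⁻¹ * ·))
    (Finset.mem_image.2 ⟨a, ha, inv_mul_cancel₀ ha0⟩) (by rwa [hcard]) hn
  rwa [hcard, ncard_permSet_image_mul n A (inv_ne_zero ha0)] at h
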